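/- Let P = (p, r) be a packing of n disks in the torus ℝ²/Λ(a, b) (Λ(a, b) with basis (a, 0), (b, 1/a), a > 0, and p₁ = 0), and let E be a finite set of triples (i, j, λ), λ ∈ Λ(a, b), containing all contacts of P, such that the segments from pᵢ to pⱼ − λ, taken modulo Λ(a, b), form a geodesic triangulation of the torus with vertex set {p₁, …, pₙ} and such that the inversive distance σ(i, j, λ) ≥ 0 on every edge of E. Then P is locally determined by its inversive distances: there exists ε > 0 such that if (q, s, (a′, b′)) with q₁ = 0 satisfies |q − p| < ε, |s − r| < ε, |(a′, b′) − (a, b)| < ε, realizes the same combinatorial triangulation E (with λ ∈ Λ(a′, b′) corresponding under the basis), and has the same inversive distance on every edge of E, then (q, s, (a′, b′)) = (p, r, (a, b)). -/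

import Mathlib

noncomputable section

open scoped RealInnerProductSpace

namespace IsostaticPaper

/-- Points of the Euclidean plane `ℝ²`. -/
abbrev Pt : Type := EuclideanSpace ℝ (Fin 2)

/-- The point `(x, y) ∈ ℝ²`. -/
def vec (x y : ℝ) : Pt := (WithLp.equiv 2 (Fin 2 → ℝ)).symm ![x, y]

/-- The lattice `Λ ⊆ ℝ²` spanned over `ℤ` by the two vectors `v₁, v₂`. -/
def lat (v₁ v₂ : Pt) : Set Pt :=
  {l : Pt | ∃ z₁ z₂ : ℤ, l = (z₁ : ℝ) • v₁ + (z₂ : ℝ) • v₂}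

/-- `(p, r)` is a packing of disks in the flat torus `ℝ²/Λ`:
all radii are positive and `‖pᵢ - pⱼ + λ‖ ≥ rᵢ + rⱼ` for all `i, j` and all
`λ ∈ Λ` with `(j, λ) ≠ (i, 0)`. -/
def IsPacking (Λ : Set Pt) {ι : Type} (p : ι → Pt) (r : ι → ℝ) : Prop :=
  (∀ i, 0 < r i) ∧
  ∀ i j : ι, ∀ l ∈ Λ, ¬(j = i ∧ l = 0) → r i + r j ≤ ‖p i - p j + l‖

/-- A contact of the packing `(p, r)` is a triple `(i, j, λ)`, `λ ∈ Λ`,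
`(j, λ) ≠ (i, 0)`, with `‖pᵢ - pⱼ + λ‖ = rᵢ + rⱼ`. -/
def IsContact (Λ : Set Pt) {ι : Type} (p : ι → Pt) (r : ι → ℝ) (c : ι × ι × Pt) : Prop :=
  c.2.2 ∈ Λ ∧ ¬(c.2.1 = c.1 ∧ c.2.2 = 0) ∧ ‖p c.1 - p c.2.1 + c.2.2‖ = r c.1 + r c.2.1

/-- A packing `(p, r)` in `ℝ²/Λ` is collectively jammed if every continuous path of
configurations `t ↦ q t`, `t ∈ [0,1]`, starting at `p` and keeping `(q t, r)` a packing,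
moves `p` only by translations. -/
def CollectivelyJammed (Λ : Set Pt) {ι : Type} (p : ι → Pt) (r : ι → ℝ) : Prop :=
  ∀ q : ℝ → ι → Pt,
    (∀ i, ContinuousOn (fun t => q t i) (Set.Icc 0 1)) →
    q 0 = p →
    (∀ t ∈ Set.Icc (0:ℝ) 1, IsPacking Λ (q t) r) →
    ∀ t ∈ Set.Icc (0:ℝ) 1, ∀ i j, q t i - p i = q t j - p j

/-- Euclidean distance between two configurations of centers. -/
def pdist {ι : Type} [Fintype ι] (p q : ι → Pt) : ℝ :=
  Real.sqrt (∑ i, ‖p i - q i‖ ^ 2)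

/-- Euclidean distance between two vectors of radii. -/
def rdist {ι : Type} [Fintype ι] (r s : ι → ℝ) : ℝ :=
  Real.sqrt (∑ i, (r i - s i) ^ 2)

/-- Determinant of the pair of lattice basis vectors `v₁, v₂`. -/
def det2 (v₁ v₂ : Pt) : ℝ := v₁ 0 * v₂ 1 - v₁ 1 * v₂ 0

/-- Density of a packing with radii `r` in the torus with lattice basis `v₁, v₂`. -/
def density (v₁ v₂ : Pt) {ι : Type} [Fintype ι] (r : ι → ℝ) : ℝ :=
  Real.pi * (∑ i, r i ^ 2) / |det2 v₁ v₂|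

/-- `(p, r)` is locally maximally dense in the torus with lattice basis `v₁, v₂`:
it is a packing and, for some `ε > 0`, every nearby packing whose radii are a positive
scalar multiple of `r` has density at most that of `(p, r)`. -/
def LocallyMaxDense (v₁ v₂ : Pt) {ι : Type} [Fintype ι] (p : ι → Pt) (r : ι → ℝ) : Prop :=
  IsPacking (lat v₁ v₂) p r ∧
  ∃ ε > 0, ∀ (q : ι → Pt) (t : ℝ), 0 < t →
    IsPacking (lat v₁ v₂) q (fun i => t * r i) →
    pdist q p < ε → rdist (fun i => t * r i) r < ε →
    density v₁ v₂ (fun i => t * r i) ≤ density v₁ v₂ r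

/-- An infinitesimal flex `p'` of the packing: `(pᵢ - pⱼ + λ) · (p'ᵢ - p'ⱼ) ≥ 0`
for every contact `(i, j, λ)`. -/
def IsInfFlex (Λ : Set Pt) {ι : Type} (p : ι → Pt) (r : ι → ℝ) (p' : ι → Pt) : Prop :=
  ∀ c : ι × ι × Pt, IsContact Λ p r c →
    0 ≤ ⟪p c.1 - p c.2.1 + c.2.2, p' c.1 - p' c.2.1⟫

/-- The packing is infinitesimally rigid if every infinitesimal flex is trivial
(all `p'ᵢ` equal). -/
def InfinitesimallyRigid (Λ : Set Pt) {ι : Type} (p : ι → Pt) (r : ι → ℝ) : Prop :=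
  ∀ p' : ι → Pt, IsInfFlex Λ p r p' → ∀ i j, p' i = p' j

/-- The space of equilibrium stresses of a packing whose (finite) set of ordered
contact triples is `K`: scalars on contacts with `ω(i,j,λ) = ω(j,i,-λ)`, vanishing off
`K`, in equilibrium at every vertex. -/
def stressSpace {n : ℕ} (K : Finset (Fin n × Fin n × Pt)) (p : Fin n → Pt) :
    Submodule ℝ ((Fin n × Fin n × Pt) → ℝ) where
  carrier := {ω | (∀ c ∉ K, ω c = 0) ∧
    (∀ i j l, ω (i, j, l) = ω (j, i, -l)) ∧
    (∀ i, ∑ c ∈ K.filter (fun c => c.1 = i), ω c • (p c.1 - p c.2.1 + c.2.2) = 0)}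
  zero_mem' := ⟨fun _ _ => rfl, fun _ _ _ => rfl, fun i => by simp⟩
  add_mem' := by
    rintro ω₁ ω₂ ⟨h1, h2, h3⟩ ⟨g1, g2, g3⟩
    refine ⟨fun c hc => ?_, fun i j l => ?_, fun i => ?_⟩
    · simp [h1 c hc, g1 c hc]
    · simp [h2 i j l, g2 i j l]
    · simp only [Pi.add_apply, add_smul, Finset.sum_add_distrib, h3 i, g3 i, add_zero]
  smul_mem' := by
    rintro t ω ⟨h1, h2, h3⟩
    refine ⟨fun c hc => ?_, fun i j l => ?_, fun i => ?_⟩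
    · simp [h1 c hc]
    · simp [h2 i j l]
    · simp only [Pi.smul_apply, smul_assoc, ← Finset.smul_sum, h3 i, smul_zero]


/-- For `a > 0` and `b`, the unit-determinant lattice `Λ(a, b)` with basis
`(a, 0), (b, 1/a)`. -/
def latAB (a b : ℝ) : Set Pt := lat (vec a 0) (vec b (1 / a))

/-- The lattice vector of `Λ(a, b)` with integer coordinates `z = (z₁, z₂)`. -/
def lvec (a b : ℝ) (z : ℤ × ℤ) : Pt :=
  (z.1 : ℝ) • vec a 0 + (z.2 : ℝ) • vec b (1 / a)

/-- The contact graph of the packing `(p, r)` in `ℝ²/Λ(a, b)`, with lattice vectors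
recorded by their integer coordinates in the basis `(a, 0), (b, 1/a)`. -/
def contactGraphZ (a b : ℝ) {n : ℕ} (p : Fin n → Pt) (r : Fin n → ℝ) :
    Set (Fin n × Fin n × ℤ × ℤ) :=
  {c | ¬(c.2.1 = c.1 ∧ c.2.2 = (0, 0)) ∧
    ‖p c.1 - p c.2.1 + lvec a b c.2.2‖ = r c.1 + r c.2.1}

/-- All segments in the plane (as ordered pairs of endpoints) obtained from the edge
set `E` by translating the segment from `pᵢ` to `pⱼ - λ` by lattice vectors of
`Λ(a, b)`; these are the lifts to the universal cover of the edges drawn on the torus. -/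
def planeSegs (a b : ℝ) {n : ℕ} (p : Fin n → Pt) (E : Finset (Fin n × Fin n × ℤ × ℤ)) :
    Set (Pt × Pt) :=
  {e | ∃ c ∈ E, ∃ m : ℤ × ℤ,
    e = (p c.1 + lvec a b m, p c.2.1 - lvec a b c.2.2 + lvec a b m)}

/-- The edge set `E` (with lattice vectors in integer coordinates) forms a geodesic
triangulation of the torus `ℝ²/Λ(a, b)` with vertex set the centers `p`:
`E` is symmetric with nondegenerate edges, every vertex meets an edge, in the universal
cover two distinct edges meet only in common endpoints, and every point off the edges
lies in an open triangle bounded by three edges and free of edge points. -/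
def IsGeodesicTriangulationZ (a b : ℝ) {n : ℕ} (p : Fin n → Pt)
    (E : Finset (Fin n × Fin n × ℤ × ℤ)) : Prop :=
  (∀ c ∈ E, (c.2.1, c.1, -c.2.2) ∈ E ∧ p c.1 ≠ p c.2.1 - lvec a b c.2.2) ∧
  (∀ i : Fin n, ∃ c ∈ E, c.1 = i) ∧
  (∀ e₁ ∈ planeSegs a b p E, ∀ e₂ ∈ planeSegs a b p E,
    ({e₁.1, e₁.2} : Set Pt) ≠ ({e₂.1, e₂.2} : Set Pt) →
    segment ℝ e₁.1 e₁.2 ∩ segment ℝ e₂.1 e₂.2 ⊆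
      ({e₁.1, e₁.2} : Set Pt) ∩ ({e₂.1, e₂.2} : Set Pt)) ∧
  (∀ x : Pt, (∀ e ∈ planeSegs a b p E, x ∉ segment ℝ e.1 e.2) →
    ∃ u v w : Pt, (u, v) ∈ planeSegs a b p E ∧ (v, w) ∈ planeSegs a b p E ∧
      (w, u) ∈ planeSegs a b p E ∧
      x ∈ interior (convexHull ℝ ({u, v, w} : Set Pt)) ∧
      ∀ y ∈ interior (convexHull ℝ ({u, v, w} : Set Pt)),
        ∀ e ∈ planeSegs a b p E, y ∉ segment ℝ e.1 e.2)

/-- The inversive distance between the circles of centers `x, y` and radii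
`r₁, r₂`. -/
def invDist (x y : Pt) (r₁ r₂ : ℝ) : ℝ :=
  (‖x - y‖ ^ 2 - (r₁ ^ 2 + r₂ ^ 2)) / (2 * r₁ * r₂)

/-- The conductance (up to a positive factor) which a triangle of circles with radii `r₁, r₂, r₃`
and inversive distances `s₁₂, s₂₃, s₃₁` puts on its edge `12`. -/
def conductance (r₁ r₂ r₃ s₁₂ s₂₃ s₃₁ : ℝ) : ℝ :=
  r₁ ^ 2 * r₂ ^ 2 * (1 - s₁₂ ^ 2) + r₁ * r₂ ^ 2 * r₃ * (s₃₁ + s₁₂ * s₂₃)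
    + r₁ ^ 2 * r₂ * r₃ * (s₂₃ + s₁₂ * s₃₁)

theorem angle_form_eq (r₁ r₂ r₃ s₁₂ s₂₃ s₃₁ u₁ u₂ u₃ L₁ L₂ L₃ α₁ α₂ α₃ : ℝ)
    (hL₁ : L₁ = r₁ ^ 2 + r₂ ^ 2 + 2 * s₁₂ * r₁ * r₂)
    (hL₂ : L₂ = r₂ ^ 2 + r₃ ^ 2 + 2 * s₂₃ * r₂ * r₃)
    (hL₃ : L₃ = r₃ ^ 2 + r₁ ^ 2 + 2 * s₃₁ * r₃ * r₁)
    (h1 : L₁ ≠ 0) (h2 : L₂ ≠ 0) (h3 : L₃ ≠ 0)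
    (ha₁ : α₁ * L₁ = r₁ ^ 2 * u₁ + r₂ ^ 2 * u₂ + s₁₂ * r₁ * r₂ * (u₁ + u₂))
    (ha₂ : α₂ * L₂ = r₂ ^ 2 * u₂ + r₃ ^ 2 * u₃ + s₂₃ * r₂ * r₃ * (u₂ + u₃))
    (ha₃ : α₃ * L₃ = r₃ ^ 2 * u₃ + r₁ ^ 2 * u₁ + s₃₁ * r₃ * r₁ * (u₃ + u₁)) :
    u₁ * (α₁ * ((L₃ - L₁ - L₂) / 2) + α₂ * L₂ + α₃ * ((L₁ - L₂ - L₃) / 2))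
      + u₂ * (α₁ * ((L₂ - L₃ - L₁) / 2) + α₂ * ((L₁ - L₂ - L₃) / 2) + α₃ * L₃)
      + u₃ * (α₁ * L₁ + α₂ * ((L₃ - L₁ - L₂) / 2) + α₃ * ((L₂ - L₃ - L₁) / 2))
    = -(conductance r₁ r₂ r₃ s₁₂ s₂₃ s₃₁ / L₁ * (u₁ - u₂) ^ 2
      + conductance r₂ r₃ r₁ s₂₃ s₃₁ s₁₂ / L₂ * (u₂ - u₃) ^ 2
      + conductance r₃ r₁ r₂ s₃₁ s₁₂ s₂₃ / L₃ * (u₃ - u₁) ^ 2) := by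
  obtain rfl := eq_div_of_mul_eq h1 ha₁
  obtain rfl := eq_div_of_mul_eq h2 ha₂
  obtain rfl := eq_div_of_mul_eq h3 ha₃
  unfold conductance
  field_simp
  subst hL₁ hL₂ hL₃
  ring

theorem conductance_det_eq (r₁ r₂ r₃ s₁₂ s₂₃ s₃₁ : ℝ) :
    conductance r₁ r₂ r₃ s₁₂ s₂₃ s₃₁ * conductance r₂ r₃ r₁ s₂₃ s₃₁ s₁₂
        * (r₃ ^ 2 + r₁ ^ 2 + 2 * s₃₁ * r₃ * r₁)
      + conductance r₂ r₃ r₁ s₂₃ s₃₁ s₁₂ * conductance r₃ r₁ r₂ s₃₁ s₁₂ s₂₃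
        * (r₁ ^ 2 + r₂ ^ 2 + 2 * s₁₂ * r₁ * r₂)
      + conductance r₃ r₁ r₂ s₃₁ s₁₂ s₂₃ * conductance r₁ r₂ r₃ s₁₂ s₂₃ s₃₁
        * (r₂ ^ 2 + r₃ ^ 2 + 2 * s₂₃ * r₂ * r₃)
    = (conductance r₁ r₂ r₃ s₁₂ s₂₃ s₃₁ + conductance r₂ r₃ r₁ s₂₃ s₃₁ s₁₂
        + conductance r₃ r₁ r₂ s₃₁ s₁₂ s₂₃)
      * (2 * r₁ ^ 2 * r₂ ^ 2 * r₃ ^ 2 * (1 + s₁₂ * s₂₃ * s₃₁)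
        + r₁ * r₂ * r₃ ^ 2 * (r₁ ^ 2 + r₂ ^ 2) * (s₁₂ + s₂₃ * s₃₁)
        + r₂ * r₃ * r₁ ^ 2 * (r₂ ^ 2 + r₃ ^ 2) * (s₂₃ + s₁₂ * s₃₁)
        + r₃ * r₁ * r₂ ^ 2 * (r₃ ^ 2 + r₁ ^ 2) * (s₃₁ + s₂₃ * s₁₂)) := by
  unfold conductance
  ring

theorem conductance_sum_eq (r₁ r₂ r₃ s₁₂ s₂₃ s₃₁ L₁ L₂ L₃ : ℝ)
    (hL₁ : L₁ = r₁ ^ 2 + r₂ ^ 2 + 2 * s₁₂ * r₁ * r₂)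
    (hL₂ : L₂ = r₂ ^ 2 + r₃ ^ 2 + 2 * s₂₃ * r₂ * r₃)
    (hL₃ : L₃ = r₃ ^ 2 + r₁ ^ 2 + 2 * s₃₁ * r₃ * r₁) :
    conductance r₁ r₂ r₃ s₁₂ s₂₃ s₃₁ + conductance r₂ r₃ r₁ s₂₃ s₃₁ s₁₂
        + conductance r₃ r₁ r₂ s₃₁ s₁₂ s₂₃
      = L₁ * L₂ - ((L₃ - L₁ - L₂) / 2) ^ 2 := by
  subst hL₁ hL₂ hL₃
  unfold conductance
  ring

/-- At most one of the conductances of a triangle is nonpositive. -/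
theorem conductance_pos_or {r₁ r₂ r₃ s₁₂ s₂₃ s₃₁ : ℝ} (hr₁ : 0 < r₁) (hr₂ : 0 < r₂)
    (hr₃ : 0 < r₃) (h₁₂ : 0 ≤ s₁₂) (h₂₃ : 0 ≤ s₂₃) (h₃₁ : 0 ≤ s₃₁) :
    0 < conductance r₁ r₂ r₃ s₁₂ s₂₃ s₃₁ ∨ 0 < conductance r₂ r₃ r₁ s₂₃ s₃₁ s₁₂ := by
  by_contra! h
  obtain ⟨h1, h2⟩ := h
  have e1 : conductance r₁ r₂ r₃ s₁₂ s₂₃ s₃₁ = r₁ * r₂ *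
      (r₂ * (s₁₂ * (r₃ * s₂₃ - r₁ * s₁₂)) + (r₁ * r₂ + r₂ * r₃ * s₃₁
        + r₁ * r₃ * (s₂₃ + s₁₂ * s₃₁))) := by
    unfold conductance; ring
  have e2 : conductance r₂ r₃ r₁ s₂₃ s₃₁ s₁₂ = r₂ * r₃ *
      (r₂ * (s₂₃ * (r₁ * s₁₂ - r₃ * s₂₃)) + (r₂ * r₃ + r₂ * r₁ * s₃₁
        + r₁ * r₃ * (s₁₂ + s₂₃ * s₃₁))) := by
    unfold conductance; ring
  rcases le_total (r₁ * s₁₂) (r₃ * s₂₃) with h | h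
  · have : 0 ≤ r₃ * s₂₃ - r₁ * s₁₂ := by linarith
    rw [e1] at h1
    refine absurd h1 (not_le.2 ?_)
    positivity
  · have : 0 ≤ r₁ * s₁₂ - r₃ * s₂₃ := by linarith
    rw [e2] at h2
    refine absurd h2 (not_le.2 ?_)
    positivity

theorem quadratic_form_pos_of_pair {w₁ w₂ w₃ x₁ x₂ x₃ : ℝ} (hx : x₁ + x₂ + x₃ = 0)
    (hw : 0 < w₁ + w₂) (hdet : 0 < w₁ * w₂ + w₂ * w₃ + w₃ * w₁) (hne : ¬ (x₁ = 0 ∧ x₂ = 0)) :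
    0 < w₁ * x₁ ^ 2 + w₂ * x₂ ^ 2 + w₃ * x₃ ^ 2 := by
  have key : (w₁ + w₂) * (w₁ * x₁ ^ 2 + w₂ * x₂ ^ 2 + w₃ * x₃ ^ 2)
      = (w₁ * x₁ - w₂ * x₂) ^ 2 + (w₁ * w₂ + w₂ * w₃ + w₃ * w₁) * (x₁ + x₂) ^ 2 := by
    obtain rfl : x₃ = -(x₁ + x₂) := by linarith
    ring
  refine pos_of_mul_pos_right (a := w₁ + w₂) ?_ hw.le
  rw [key]
  by_cases h : x₁ + x₂ = 0
  · obtain rfl : x₂ = -x₁ := by linarith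
    have h1 : x₁ ≠ 0 := fun h1 => hne ⟨h1, by simp [h1]⟩
    have : w₁ * x₁ - w₂ * -x₁ ≠ 0 := by
      rw [show w₁ * x₁ - w₂ * -x₁ = (w₁ + w₂) * x₁ by ring]
      exact mul_ne_zero hw.ne' h1
    have := pow_pos (abs_pos.2 this) 2
    rw [sq_abs] at this
    simpa using this
  · have := mul_pos hdet (pow_pos (abs_pos.2 h) 2)
    rw [sq_abs] at this
    nlinarith [sq_nonneg (w₁ * x₁ - w₂ * x₂)]

theorem quadratic_form_pos {w₁ w₂ w₃ x₁ x₂ x₃ : ℝ} (hx : x₁ + x₂ + x₃ = 0)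
    (h₁₂ : 0 < w₁ ∨ 0 < w₂) (h₂₃ : 0 < w₂ ∨ 0 < w₃) (h₃₁ : 0 < w₃ ∨ 0 < w₁)
    (hdet : 0 < w₁ * w₂ + w₂ * w₃ + w₃ * w₁) (hne : ¬ (x₁ = 0 ∧ x₂ = 0)) :
    0 < w₁ * x₁ ^ 2 + w₂ * x₂ ^ 2 + w₃ * x₃ ^ 2 := by
  by_cases h : 0 < w₁ + w₂
  · exact quadratic_form_pos_of_pair hx h hdet hne
  by_cases h' : 0 < w₂ + w₃
  · have := quadratic_form_pos_of_pair (w₁ := w₂) (w₂ := w₃) (w₃ := w₁) (x₁ := x₂) (x₂ := x₃)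
      (x₃ := x₁) (by linarith) h' (by linarith)
      (fun hh => hne ⟨by linarith [hh.1, hh.2], hh.1⟩)
    linarith
  by_cases h'' : 0 < w₃ + w₁
  · have := quadratic_form_pos_of_pair (w₁ := w₃) (w₂ := w₁) (w₃ := w₂) (x₁ := x₃) (x₂ := x₁)
      (x₃ := x₂) (by linarith) h'' (by linarith)
      (fun hh => hne ⟨hh.2, by linarith [hh.1, hh.2]⟩)
    linarith
  · exfalso
    rcases h₁₂ with h1 | h1 <;> rcases h₂₃ with h2 | h2 <;> rcases h₃₁ with h3 | h3 <;> linarith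

/-- The conductance form of a nondegenerate triangle is positive definite modulo constants. -/
theorem conductance_form_pos {r₁ r₂ r₃ s₁₂ s₂₃ s₃₁ u₁ u₂ u₃ L₁ L₂ L₃ : ℝ}
    (hr₁ : 0 < r₁) (hr₂ : 0 < r₂) (hr₃ : 0 < r₃)
    (h₁₂ : 0 ≤ s₁₂) (h₂₃ : 0 ≤ s₂₃) (h₃₁ : 0 ≤ s₃₁)
    (hL₁ : L₁ = r₁ ^ 2 + r₂ ^ 2 + 2 * s₁₂ * r₁ * r₂)
    (hL₂ : L₂ = r₂ ^ 2 + r₃ ^ 2 + 2 * s₂₃ * r₂ * r₃)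
    (hL₃ : L₃ = r₃ ^ 2 + r₁ ^ 2 + 2 * s₃₁ * r₃ * r₁)
    (harea : 0 < L₁ * L₂ - ((L₃ - L₁ - L₂) / 2) ^ 2) (hne : ¬ (u₁ = u₂ ∧ u₂ = u₃)) :
    0 < conductance r₁ r₂ r₃ s₁₂ s₂₃ s₃₁ / L₁ * (u₁ - u₂) ^ 2
      + conductance r₂ r₃ r₁ s₂₃ s₃₁ s₁₂ / L₂ * (u₂ - u₃) ^ 2
      + conductance r₃ r₁ r₂ s₃₁ s₁₂ s₂₃ / L₃ * (u₃ - u₁) ^ 2 := by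
  have p1 : 0 < L₁ := by rw [hL₁]; positivity
  have p2 : 0 < L₂ := by rw [hL₂]; positivity
  have p3 : 0 < L₃ := by rw [hL₃]; positivity
  refine quadratic_form_pos (by ring)
    ((conductance_pos_or hr₁ hr₂ hr₃ h₁₂ h₂₃ h₃₁).imp (div_pos · p1) (div_pos · p2))
    ((conductance_pos_or hr₂ hr₃ hr₁ h₂₃ h₃₁ h₁₂).imp (div_pos · p2) (div_pos · p3))
    ((conductance_pos_or hr₃ hr₁ hr₂ h₃₁ h₁₂ h₂₃).imp (div_pos · p3) (div_pos · p1)) ?_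
    (fun h => hne ⟨sub_eq_zero.1 h.1, sub_eq_zero.1 h.2⟩)
  have key := conductance_det_eq r₁ r₂ r₃ s₁₂ s₂₃ s₃₁
  rw [conductance_sum_eq r₁ r₂ r₃ s₁₂ s₂₃ s₃₁ L₁ L₂ L₃ hL₁ hL₂ hL₃, ← hL₁, ← hL₂, ← hL₃] at key
  have hpos : 0 < (L₁ * L₂ - ((L₃ - L₁ - L₂) / 2) ^ 2) *
      (2 * r₁ ^ 2 * r₂ ^ 2 * r₃ ^ 2 * (1 + s₁₂ * s₂₃ * s₃₁)
        + r₁ * r₂ * r₃ ^ 2 * (r₁ ^ 2 + r₂ ^ 2) * (s₁₂ + s₂₃ * s₃₁)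
        + r₂ * r₃ * r₁ ^ 2 * (r₂ ^ 2 + r₃ ^ 2) * (s₂₃ + s₁₂ * s₃₁)
        + r₃ * r₁ * r₂ ^ 2 * (r₃ ^ 2 + r₁ ^ 2) * (s₃₁ + s₂₃ * s₁₂)) :=
    mul_pos harea (by positivity)
  rw [← key] at hpos
  refine lt_of_lt_of_eq (div_pos hpos (mul_pos (mul_pos p1 p2) p3)) ?_
  field_simp

/-- The rate of rotation of the edge vector `(x, y)` moving with velocity `(a, b)`. -/
def spin (x y a b : ℝ) : ℝ := (x * b - y * a) / (x ^ 2 + y ^ 2)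

theorem spin_neg (x y a b : ℝ) : spin (-x) (-y) (-a) (-b) = spin x y a b := by
  simp [spin]

theorem velocity_decomp {x y a b L α : ℝ} (hL : L = x ^ 2 + y ^ 2) (h : L ≠ 0)
    (hα : α * L = x * a + y * b) :
    a = α * x - spin x y a b * y ∧ b = α * y + spin x y a b * x := by
  obtain rfl := eq_div_of_mul_eq h hα
  subst hL
  unfold spin
  constructor <;> field_simp <;> ring

/-- Differences of the rates of rotation of the edges of a triangle in terms of their rates of
dilation. -/
theorem area_mul_spin_sub {x₁ y₁ x₂ y₂ x₃ y₃ a₁ b₁ a₂ b₂ a₃ b₃ α₁ α₂ α₃ ω₁ ω₂ ω₃ : ℝ}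
    (hx : x₁ + x₂ + x₃ = 0) (hy : y₁ + y₂ + y₃ = 0) (ha : a₁ + a₂ + a₃ = 0)
    (hb : b₁ + b₂ + b₃ = 0)
    (h₁ : a₁ = α₁ * x₁ - ω₁ * y₁ ∧ b₁ = α₁ * y₁ + ω₁ * x₁)
    (h₂ : a₂ = α₂ * x₂ - ω₂ * y₂ ∧ b₂ = α₂ * y₂ + ω₂ * x₂)
    (h₃ : a₃ = α₃ * x₃ - ω₃ * y₃ ∧ b₃ = α₃ * y₃ + ω₃ * x₃) :
    (x₁ * y₂ - y₁ * x₂) * (ω₂ - ω₃) = α₁ * (x₁ ^ 2 + y₁ ^ 2) + α₂ * (x₁ * x₂ + y₁ * y₂)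
      + α₃ * (x₁ * x₃ + y₁ * y₃) := by
  obtain ⟨rfl, rfl⟩ := h₁
  obtain ⟨rfl, rfl⟩ := h₂
  obtain ⟨rfl, rfl⟩ := h₃
  obtain rfl : x₃ = -(x₁ + x₂) := by linarith
  obtain rfl : y₃ = -(y₁ + y₂) := by linarith
  linear_combination (-x₁) * ha - y₁ * hb

/-- The angle variation form of a triangle of circles under a motion which preserves inversive
distances: it is nonpositive, it vanishes only on conformal factors which are constant on the
triangle, and in that case the triangle rotates rigidly. -/
theorem triangle_spin {x₁ y₁ x₂ y₂ x₃ y₃ a₁ b₁ a₂ b₂ a₃ b₃ r₁ r₂ r₃ s₁₂ s₂₃ s₃₁ u₁ u₂ u₃ : ℝ}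
    (hx : x₁ + x₂ + x₃ = 0) (hy : y₁ + y₂ + y₃ = 0) (ha : a₁ + a₂ + a₃ = 0)
    (hb : b₁ + b₂ + b₃ = 0) (harea : 0 < x₁ * y₂ - y₁ * x₂)
    (hr₁ : 0 < r₁) (hr₂ : 0 < r₂) (hr₃ : 0 < r₃)
    (h₁₂ : 0 ≤ s₁₂) (h₂₃ : 0 ≤ s₂₃) (h₃₁ : 0 ≤ s₃₁)
    (hL₁ : x₁ ^ 2 + y₁ ^ 2 = r₁ ^ 2 + r₂ ^ 2 + 2 * s₁₂ * r₁ * r₂)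
    (hL₂ : x₂ ^ 2 + y₂ ^ 2 = r₂ ^ 2 + r₃ ^ 2 + 2 * s₂₃ * r₂ * r₃)
    (hL₃ : x₃ ^ 2 + y₃ ^ 2 = r₃ ^ 2 + r₁ ^ 2 + 2 * s₃₁ * r₃ * r₁)
    (hv₁ : x₁ * a₁ + y₁ * b₁ = r₁ ^ 2 * u₁ + r₂ ^ 2 * u₂ + s₁₂ * r₁ * r₂ * (u₁ + u₂))
    (hv₂ : x₂ * a₂ + y₂ * b₂ = r₂ ^ 2 * u₂ + r₃ ^ 2 * u₃ + s₂₃ * r₂ * r₃ * (u₂ + u₃))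
    (hv₃ : x₃ * a₃ + y₃ * b₃ = r₃ ^ 2 * u₃ + r₁ ^ 2 * u₁ + s₃₁ * r₃ * r₁ * (u₃ + u₁)) :
    (¬ (u₁ = u₂ ∧ u₂ = u₃) → spin x₁ y₁ a₁ b₁ * (u₂ - u₁) + spin x₂ y₂ a₂ b₂ * (u₃ - u₂)
      + spin x₃ y₃ a₃ b₃ * (u₁ - u₃) < 0) ∧
    (u₁ = u₂ ∧ u₂ = u₃ → spin x₁ y₁ a₁ b₁ = spin x₂ y₂ a₂ b₂) := by
  obtain ⟨L₁, l1⟩ : ∃ L, L = x₁ ^ 2 + y₁ ^ 2 := ⟨_, rfl⟩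
  obtain ⟨L₂, l2⟩ : ∃ L, L = x₂ ^ 2 + y₂ ^ 2 := ⟨_, rfl⟩
  obtain ⟨L₃, l3⟩ : ∃ L, L = x₃ ^ 2 + y₃ ^ 2 := ⟨_, rfl⟩
  rw [← l1] at hL₁
  rw [← l2] at hL₂
  rw [← l3] at hL₃
  have p1 : 0 < L₁ := by rw [hL₁]; positivity
  have p2 : 0 < L₂ := by rw [hL₂]; positivity
  have p3 : 0 < L₃ := by rw [hL₃]; positivity
  obtain ⟨α₁, e1⟩ : ∃ α, α * L₁ = x₁ * a₁ + y₁ * b₁ := ⟨_, div_mul_cancel₀ _ p1.ne'⟩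
  obtain ⟨α₂, e2⟩ : ∃ α, α * L₂ = x₂ * a₂ + y₂ * b₂ := ⟨_, div_mul_cancel₀ _ p2.ne'⟩
  obtain ⟨α₃, e3⟩ : ∃ α, α * L₃ = x₃ * a₃ + y₃ * b₃ := ⟨_, div_mul_cancel₀ _ p3.ne'⟩
  have d1 := velocity_decomp l1 p1.ne' e1
  have d2 := velocity_decomp l2 p2.ne' e2
  have d3 := velocity_decomp l3 p3.ne' e3
  have i12 : x₁ * x₂ + y₁ * y₂ = (L₃ - L₁ - L₂) / 2 := by
    obtain rfl : x₃ = -(x₁ + x₂) := by linarith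
    obtain rfl : y₃ = -(y₁ + y₂) := by linarith
    rw [l1, l2, l3]; ring
  have i23 : x₂ * x₃ + y₂ * y₃ = (L₁ - L₂ - L₃) / 2 := by
    obtain rfl : x₁ = -(x₂ + x₃) := by linarith
    obtain rfl : y₁ = -(y₂ + y₃) := by linarith
    rw [l1, l2, l3]; ring
  have i31 : x₃ * x₁ + y₃ * y₁ = (L₂ - L₃ - L₁) / 2 := by
    obtain rfl : x₂ = -(x₁ + x₃) := by linarith
    obtain rfl : y₂ = -(y₁ + y₃) := by linarith
    rw [l1, l2, l3]; ring
  have A2 : x₂ * y₃ - y₂ * x₃ = x₁ * y₂ - y₁ * x₂ := by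
    obtain rfl : x₃ = -(x₁ + x₂) := by linarith
    obtain rfl : y₃ = -(y₁ + y₂) := by linarith
    ring
  have A3 : x₃ * y₁ - y₃ * x₁ = x₁ * y₂ - y₁ * x₂ := by
    obtain rfl : x₃ = -(x₁ + x₂) := by linarith
    obtain rfl : y₃ = -(y₁ + y₂) := by linarith
    ring
  have f1 := area_mul_spin_sub hx hy ha hb d1 d2 d3
  have f2 := area_mul_spin_sub (x₁ := x₂) (x₂ := x₃) (x₃ := x₁) (y₁ := y₂) (y₂ := y₃) (y₃ := y₁)
    (by linarith) (by linarith) (by linarith) (by linarith) d2 d3 d1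
  have f3 := area_mul_spin_sub (x₁ := x₃) (x₂ := x₁) (x₃ := x₂) (y₁ := y₃) (y₂ := y₁) (y₃ := y₂)
    (by linarith) (by linarith) (by linarith) (by linarith) d3 d1 d2
  rw [← l1, i12, show x₁ * x₃ + y₁ * y₃ = x₃ * x₁ + y₃ * y₁ by ring, i31] at f1
  rw [A2, ← l2, i23, show x₂ * x₁ + y₂ * y₁ = x₁ * x₂ + y₁ * y₂ by ring, i12] at f2
  rw [A3, ← l3, i31, show x₃ * x₂ + y₃ * y₂ = x₂ * x₃ + y₂ * y₃ by ring, i23] at f3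
  generalize spin x₁ y₁ a₁ b₁ = ω₁ at *
  generalize spin x₂ y₂ a₂ b₂ = ω₂ at *
  generalize spin x₃ y₃ a₃ b₃ = ω₃ at *
  rw [hv₁] at e1
  rw [hv₂] at e2
  rw [hv₃] at e3
  constructor
  · intro hne
    have hArea : 0 < L₁ * L₂ - ((L₃ - L₁ - L₂) / 2) ^ 2 := by
      rw [← i12, l1, l2]
      refine lt_of_lt_of_eq (pow_pos harea 2) ?_
      ring
    have hform := conductance_form_pos hr₁ hr₂ hr₃ h₁₂ h₂₃ h₃₁ hL₁ hL₂ hL₃ hArea hne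
    have heq := angle_form_eq r₁ r₂ r₃ s₁₂ s₂₃ s₃₁ u₁ u₂ u₃ L₁ L₂ L₃ α₁ α₂ α₃ hL₁ hL₂ hL₃
      p1.ne' p2.ne' p3.ne' e1 e2 e3
    refine neg_of_mul_neg_right (a := x₁ * y₂ - y₁ * x₂) ?_ harea.le
    have : (x₁ * y₂ - y₁ * x₂) * (ω₁ * (u₂ - u₁) + ω₂ * (u₃ - u₂) + ω₃ * (u₁ - u₃))
        = -(conductance r₁ r₂ r₃ s₁₂ s₂₃ s₃₁ / L₁ * (u₁ - u₂) ^ 2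
      + conductance r₂ r₃ r₁ s₂₃ s₃₁ s₁₂ / L₂ * (u₂ - u₃) ^ 2
      + conductance r₃ r₁ r₂ s₃₁ s₁₂ s₂₃ / L₃ * (u₃ - u₁) ^ 2) := by
      rw [← heq]
      linear_combination u₁ * f2 + u₂ * f3 + u₃ * f1
    rw [this]
    linarith
  · rintro ⟨rfl, rfl⟩
    have g1 : α₁ = u₁ := mul_right_cancel₀ p1.ne' (by rw [e1, hL₁]; ring)
    have g2 : α₂ = u₁ := mul_right_cancel₀ p2.ne' (by rw [e2, hL₂]; ring)
    have g3 : α₃ = u₁ := mul_right_cancel₀ p3.ne' (by rw [e3, hL₃]; ring)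
    rw [g1, g2, g3] at f3
    have : (x₁ * y₂ - y₁ * x₂) * (ω₁ - ω₂) = 0 := by rw [f3]; ring
    linarith [(mul_eq_zero.1 this).resolve_left harea.ne']

/-- Twice the signed area of the triangle `u v w`. -/
def orient (u v w : Pt) : ℝ := (v 0 - u 0) * (w 1 - u 1) - (v 1 - u 1) * (w 0 - u 0)

theorem orient_rotate (u v w : Pt) : orient v w u = orient u v w := by
  unfold orient; ring

theorem orient_swap (u v w : Pt) : orient v u w = -orient u v w := by
  unfold orient; ring

theorem orient_combo (u v x y : Pt) {s t : ℝ} (h : s + t = 1) :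
    orient u v (s • x + t • y) = s * orient u v x + t * orient u v y := by
  obtain rfl : s = 1 - t := by linarith
  simp only [orient, PiLp.add_apply, PiLp.smul_apply, smul_eq_mul]
  ring

theorem orient_self_left (u v : Pt) : orient u v u = 0 := by unfold orient; ring

theorem orient_self_right (u v : Pt) : orient u v v = 0 := by unfold orient; ring

theorem orient_add_left (u v w t : Pt) : orient (u + t) (v + t) (w + t) = orient u v w := by
  simp only [orient, PiLp.add_apply]
  ring

theorem continuous_orient (u v : Pt) : Continuous (orient u v) := by
  unfold orient
  fun_prop

theorem convex_orient_pos (u v : Pt) : Convex ℝ {z | 0 < orient u v z} := by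
  intro x hx y hy s t hs ht hst
  simp only [Set.mem_ofPred_eq] at hx hy ⊢
  rw [orient_combo u v x y hst]
  rcases hs.eq_or_lt with rfl | hs
  · obtain rfl : t = 1 := by linarith
    linarith
  · have := mul_pos hs hx
    have := mul_nonneg ht hy.le
    linarith

theorem convex_orient_nonneg (u v : Pt) : Convex ℝ {z | 0 ≤ orient u v z} := by
  intro x hx y hy s t hs ht hst
  simp only [Set.mem_ofPred_eq] at hx hy ⊢
  rw [orient_combo u v x y hst]
  positivity

/-- The barycenter of two points. -/
def mid (u v : Pt) : Pt := (1 / 2 : ℝ) • u + (1 / 2 : ℝ) • v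

theorem mid_mem_segment (u v : Pt) : mid u v ∈ segment ℝ u v :=
  ⟨1 / 2, 1 / 2, by norm_num, by norm_num, by norm_num, rfl⟩

theorem orient_mid (a b u v : Pt) :
    orient a b (mid u v) = (orient a b u + orient a b v) / 2 := by
  rw [mid, orient_combo _ _ _ _ (by norm_num)]; ring

theorem mid_ne_left {u v : Pt} (h : u ≠ v) : mid u v ≠ u := by
  intro h'
  apply h
  ext i
  have := congrArg (fun x : Pt => x i) h'
  simp only [mid, PiLp.add_apply, PiLp.smul_apply, smul_eq_mul] at this
  linarith

theorem mid_ne_right {u v : Pt} (h : u ≠ v) : mid u v ≠ v := by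
  have := mid_ne_left h.symm
  rwa [mid, add_comm] at this

/-- The interior of a positively oriented triangle. -/
def openTri (u v w : Pt) : Set Pt := {z | 0 < orient u v z ∧ 0 < orient v w z ∧ 0 < orient w u z}

theorem isOpen_openTri (u v w : Pt) : IsOpen (openTri u v w) :=
  (isOpen_lt continuous_const (continuous_orient u v)).inter
    ((isOpen_lt continuous_const (continuous_orient v w)).inter
      (isOpen_lt continuous_const (continuous_orient w u)))

theorem convex_openTri (u v w : Pt) : Convex ℝ (openTri u v w) :=
  (convex_orient_pos u v).inter ((convex_orient_pos v w).inter (convex_orient_pos w u))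

theorem openTri_rotate (u v w : Pt) : openTri v w u = openTri u v w := by
  ext z; simp only [openTri, Set.mem_ofPred_eq]; tauto

theorem openTri_nonempty {u v w : Pt} (h : 0 < orient u v w) : (openTri u v w).Nonempty := by
  refine ⟨(1 / 3 : ℝ) • u + (2 / 3 : ℝ) • mid v w, ?_⟩
  have h1 := orient_rotate u v w
  have h2 := orient_rotate v w u
  simp only [openTri, Set.mem_ofPred_eq,
    orient_combo _ _ _ _ (show (1 / 3 : ℝ) + 2 / 3 = 1 by norm_num),
    orient_mid, orient_self_left, orient_self_right]
  refine ⟨?_, ?_, ?_⟩ <;> linarith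

theorem orient_smul_eq (u v w z : Pt) :
    orient u v w • z = orient v w z • u + orient w u z • v + orient u v z • w := by
  ext i
  fin_cases i <;> simp [orient] <;> ring

theorem mem_segment_of_orient {u v w z : Pt} (h : 0 < orient u v w) (h0 : orient u v z = 0)
    (h1 : 0 ≤ orient v w z) (h2 : 0 ≤ orient w u z) : z ∈ segment ℝ u v := by
  have e := orient_smul_eq u v w z
  have hs : orient u v z + orient v w z + orient w u z = orient u v w := by unfold orient; ring
  refine ⟨orient v w z / orient u v w, orient w u z / orient u v w, by positivity, by positivity,
    ?_, ?_⟩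
  · rw [← add_div, div_eq_one_iff_eq h.ne']; linarith
  · rw [h0, zero_smul, add_zero] at e
    rw [div_eq_inv_mul, div_eq_inv_mul, mul_smul, mul_smul, ← smul_add, ← e, smul_smul,
      inv_mul_cancel₀ h.ne', one_smul]

theorem openTri_subset_interior {u v w : Pt} (h : 0 < orient u v w) :
    openTri u v w ⊆ interior (convexHull ℝ {u, v, w}) := by
  refine interior_maximal (fun z hz => ?_) (isOpen_openTri u v w)
  have e := orient_smul_eq u v w z
  have hs : orient u v z + orient v w z + orient w u z = orient u v w := by unfold orient; ring
  have hz' : z = (orient v w z / orient u v w) • u + (orient w u z / orient u v w) • v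
      + (orient u v z / orient u v w) • w := by
    rw [div_eq_inv_mul, div_eq_inv_mul, div_eq_inv_mul, mul_smul, mul_smul, mul_smul, ← smul_add,
      ← smul_add, ← e, smul_smul, inv_mul_cancel₀ h.ne', one_smul]
  obtain ⟨z1, z2, z3⟩ := hz
  have key := (convex_convexHull ℝ {u, v, w}).sum_mem (t := Finset.univ)
    (w := ![orient v w z / orient u v w, orient w u z / orient u v w, orient u v z / orient u v w])
    (z := ![u, v, w]) ?_ ?_ ?_
  · rw [hz']
    simpa [Fin.sum_univ_three] using key
  · intro i _
    fin_cases i <;> simp <;> positivity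
  · simp [Fin.sum_univ_three]
    rw [← add_div, ← add_div, div_eq_one_iff_eq h.ne']
    linarith
  · intro i _
    apply subset_convexHull
    fin_cases i <;> simp

theorem orient_add_perp (u v z : Pt) (s : ℝ) :
    orient u v (z + s • (!₂[-(v 1 - u 1), v 0 - u 0] : Pt))
      = orient u v z + s * ((v 0 - u 0) ^ 2 + (v 1 - u 1) ^ 2) := by
  simp [orient]; ring

theorem sq_dist_pos {u v : Pt} (h : u ≠ v) : 0 < (v 0 - u 0) ^ 2 + (v 1 - u 1) ^ 2 := by
  by_contra! hle
  have h0 : (v 0 - u 0) ^ 2 = 0 := by nlinarith [sq_nonneg (v 0 - u 0), sq_nonneg (v 1 - u 1)]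
  have h1 : (v 1 - u 1) ^ 2 = 0 := by nlinarith [sq_nonneg (v 0 - u 0), sq_nonneg (v 1 - u 1)]
  rw [sq_eq_zero_iff, sub_eq_zero] at h0 h1
  apply h
  ext i
  fin_cases i
  · exact h0.symm
  · exact h1.symm

theorem exists_small_add_smul_mem {S : Set Pt} {z : Pt} (hS : S ∈ nhds z) (x : Pt) :
    ∃ s > (0 : ℝ), ∀ t : ℝ, |t| ≤ s → z + t • x ∈ S := by
  have hc : Filter.Tendsto (fun t : ℝ => z + t • x) (nhds 0) (nhds z) := by
    have : Continuous (fun t : ℝ => z + t • x) := by fun_prop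
    simpa using this.tendsto 0
  obtain ⟨s, hs, h⟩ := Metric.mem_nhds_iff.1 (hc hS)
  refine ⟨s / 2, by positivity, fun t ht => h ?_⟩
  rw [Metric.mem_ball, Real.dist_eq, sub_zero]
  linarith

theorem orient_pos_of_mem_interior {u v w z : Pt} (huv : u ≠ v) (h : 0 ≤ orient u v w)
    (hz : z ∈ interior (convexHull ℝ {u, v, w})) : 0 < orient u v z := by
  have hsub : convexHull ℝ {u, v, w} ⊆ {z | 0 ≤ orient u v z} := by
    refine convexHull_min ?_ (convex_orient_nonneg u v)
    rintro x (rfl | rfl | rfl)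
    · exact (orient_self_left _ _).ge
    · exact (orient_self_right _ _).ge
    · exact h
  obtain ⟨s, hs, hmem⟩ := exists_small_add_smul_mem (mem_interior_iff_mem_nhds.1 hz)
    (!₂[-(v 1 - u 1), v 0 - u 0] : Pt)
  have := hsub (hmem (-s) (by rw [abs_neg, abs_of_pos hs]))
  rw [Set.mem_ofPred_eq, orient_add_perp] at this
  nlinarith [mul_pos hs (sq_dist_pos huv)]

theorem mem_openTri_of_mem_interior {u v w z : Pt} (huv : u ≠ v) (hvw : v ≠ w) (hwu : w ≠ u)
    (h : 0 ≤ orient u v w) (hz : z ∈ interior (convexHull ℝ {u, v, w})) :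
    0 < orient u v w ∧ z ∈ openTri u v w := by
  have h1 := orient_pos_of_mem_interior huv h hz
  have h2 := orient_pos_of_mem_interior (u := v) (v := w) (w := u) hvw
    (by rwa [orient_rotate])
    (by rwa [show ({v, w, u} : Set Pt) = {u, v, w} by ext; simp; tauto])
  have h3 := orient_pos_of_mem_interior (u := w) (v := u) (w := v) hwu
    (by rwa [← orient_rotate])
    (by rwa [show ({w, u, v} : Set Pt) = {u, v, w} by ext; simp; tauto])
  have hs : orient u v z + orient v w z + orient w u z = orient u v w := by unfold orient; ring
  exact ⟨by linarith, h1, h2, h3⟩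

/-- A locally finite set of (doubly) directed segments in the plane, meeting only in common
endpoints and cutting the plane into triangles. -/
structure IsPlaneTriangulation (D : Set (Pt × Pt)) : Prop where
  symm : ∀ {u v : Pt}, (u, v) ∈ D → (v, u) ∈ D
  ne : ∀ {u v : Pt}, (u, v) ∈ D → u ≠ v
  countable : D.Countable
  locallyFinite : LocallyFinite fun e : D => segment ℝ e.1.1 e.1.2
  cross : ∀ e₁ ∈ D, ∀ e₂ ∈ D, ({e₁.1, e₁.2} : Set Pt) ≠ ({e₂.1, e₂.2} : Set Pt) →
    segment ℝ e₁.1 e₁.2 ∩ segment ℝ e₂.1 e₂.2 ⊆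
      ({e₁.1, e₁.2} : Set Pt) ∩ ({e₂.1, e₂.2} : Set Pt)
  triangle : ∀ x : Pt, (∀ e ∈ D, x ∉ segment ℝ e.1 e.2) →
    ∃ u v w : Pt, (u, v) ∈ D ∧ (v, w) ∈ D ∧ (w, u) ∈ D ∧
      x ∈ interior (convexHull ℝ ({u, v, w} : Set Pt)) ∧
      ∀ y ∈ interior (convexHull ℝ ({u, v, w} : Set Pt)), ∀ e ∈ D, y ∉ segment ℝ e.1 e.2

/-- The positively oriented triangle `u v w` is a face of the triangulation `D`. -/
def IsFace (D : Set (Pt × Pt)) (u v w : Pt) : Prop :=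
  (u, v) ∈ D ∧ (v, w) ∈ D ∧ (w, u) ∈ D ∧ 0 < orient u v w ∧
    ∀ y ∈ openTri u v w, ∀ e ∈ D, y ∉ segment ℝ e.1 e.2

theorem IsFace.rotate {D : Set (Pt × Pt)} {u v w : Pt} (h : IsFace D u v w) : IsFace D v w u := by
  obtain ⟨h1, h2, h3, h4, h5⟩ := h
  exact ⟨h2, h3, h1, by rwa [orient_rotate], by rwa [openTri_rotate]⟩

theorem eq_or_swap_of_pair_eq {x y u v : Pt} (h : ({x, y} : Set Pt) = {u, v}) :
    (x = u ∧ y = v) ∨ (x = v ∧ y = u) :=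
  Set.pair_eq_pair_iff.1 h

theorem IsFace.subset_openTri {D : Set (Pt × Pt)} {u v w : Pt} (hf : IsFace D u v w) {s : Set Pt}
    (hs : IsPreconnected s) (hD : ∀ y ∈ s, ∀ e ∈ D, y ∉ segment ℝ e.1 e.2)
    (hne : (s ∩ openTri u v w).Nonempty) : s ⊆ openTri u v w := by
  obtain ⟨h1, h2, h3, h4, -⟩ := hf
  have hcl : IsClosed {z | 0 ≤ orient u v z ∧ 0 ≤ orient v w z ∧ 0 ≤ orient w u z} :=
    (isClosed_le continuous_const (continuous_orient u v)).inter
      ((isClosed_le continuous_const (continuous_orient v w)).inter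
        (isClosed_le continuous_const (continuous_orient w u)))
  refine hs.subset_left_of_subset_union (isOpen_openTri u v w) hcl.isOpen_compl ?_ ?_ hne
  · rw [Set.disjoint_left]
    exact fun z hz hz' => hz' ⟨hz.1.le, hz.2.1.le, hz.2.2.le⟩
  · intro z hz
    by_contra hcon
    simp only [Set.mem_union, Set.mem_compl_iff, not_or, not_not, Set.mem_ofPred_eq] at hcon
    obtain ⟨hno, z1, z2, z3⟩ := hcon
    rcases z1.eq_or_lt with e1 | l1
    · exact hD z hz _ h1 (mem_segment_of_orient h4 e1.symm z2 z3)
    rcases z2.eq_or_lt with e2 | l2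
    · exact hD z hz _ h2 (mem_segment_of_orient (by rwa [orient_rotate]) e2.symm z3 z1)
    rcases z3.eq_or_lt with e3 | l3
    · exact hD z hz _ h3 (mem_segment_of_orient (by rwa [← orient_rotate]) e3.symm z1 z2)
    exact hno ⟨l1, l2, l3⟩

theorem orient_nonneg_of_ray {u v m z : Pt}
    (h : ∀ t : ℝ, 0 < t → t ≤ 1 → 0 < orient u v ((1 - t) • m + t • z)) : 0 ≤ orient u v m := by
  by_contra! hneg
  have h1 := h 1 one_pos le_rfl
  simp only [sub_self, zero_smul, one_smul, zero_add] at h1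
  have hd : 0 < orient u v z - orient u v m := by linarith
  have h2 := h (-orient u v m / (orient u v z - orient u v m)) (div_pos (by linarith) hd)
    ((div_le_one hd).2 (by linarith))
  rw [orient_combo _ _ _ _ (by ring)] at h2
  have : (1 - -orient u v m / (orient u v z - orient u v m)) * orient u v m +
      -orient u v m / (orient u v z - orient u v m) * orient u v z = 0 := by
    field_simp
    ring
  linarith

namespace IsPlaneTriangulation

variable {D : Set (Pt × Pt)}

theorem eq_or_swap_of_mid_mem (hD : IsPlaneTriangulation D) {x y u v : Pt} (hxy : (x, y) ∈ D)
    (huv : (u, v) ∈ D) (hm : mid x y ∈ segment ℝ u v) : (x = u ∧ y = v) ∨ (x = v ∧ y = u) := by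
  by_contra hcon
  have := hD.cross _ hxy _ huv (fun h => hcon (eq_or_swap_of_pair_eq h)) ⟨mid_mem_segment x y, hm⟩
  rcases this.1 with h | h
  · exact mid_ne_left (hD.ne hxy) h
  · exact mid_ne_right (hD.ne hxy) h

theorem edge_of_ray (hD : IsPlaneTriangulation D) {x y u v w z : Pt} (hxy : (x, y) ∈ D)
    (hf : IsFace D u v w) (hz : 0 < orient x y z)
    (hray : ∀ t : ℝ, 0 < t → t ≤ 1 → (1 - t) • mid x y + t • z ∈ openTri u v w) :
    (x = u ∧ y = v) ∨ (x = v ∧ y = w) ∨ (x = w ∧ y = u) := by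
  have m1 := orient_nonneg_of_ray fun t h0 h1 => (hray t h0 h1).1
  have m2 := orient_nonneg_of_ray fun t h0 h1 => (hray t h0 h1).2.1
  have m3 := orient_nonneg_of_ray fun t h0 h1 => (hray t h0 h1).2.2
  have hz1 := hray 1 one_pos le_rfl
  simp only [sub_self, zero_smul, one_smul, zero_add] at hz1
  obtain ⟨z1, z2, z3⟩ := hz1
  obtain ⟨h1, h2, h3, h4, h5⟩ := hf
  have hno : mid x y ∉ openTri u v w := fun h => h5 _ h _ hxy (mid_mem_segment x y)
  rcases m1.eq_or_lt with e1 | l1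
  · rcases hD.eq_or_swap_of_mid_mem hxy h1 (mem_segment_of_orient h4 e1.symm m2 m3) with h | h
    · exact Or.inl h
    · rw [h.1, h.2, orient_swap] at hz
      linarith
  rcases m2.eq_or_lt with e2 | l2
  · rcases hD.eq_or_swap_of_mid_mem hxy h2
      (mem_segment_of_orient (by rwa [orient_rotate]) e2.symm m3 m1) with h | h
    · exact Or.inr (Or.inl h)
    · rw [h.1, h.2, orient_swap] at hz
      linarith
  rcases m3.eq_or_lt with e3 | l3
  · rcases hD.eq_or_swap_of_mid_mem hxy h3
      (mem_segment_of_orient (by rwa [← orient_rotate]) e3.symm m1 m2) with h | h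
    · exact Or.inr (Or.inr h)
    · rw [h.1, h.2, orient_swap] at hz
      linarith
  exact absurd ⟨l1, l2, l3⟩ hno

/-- Two overlapping faces have the same directed edges. -/
theorem edge_of_overlap (hD : IsPlaneTriangulation D) {x y k u v w z : Pt} (hf : IsFace D x y k)
    (hf' : IsFace D u v w) (hz : z ∈ openTri x y k) (hz' : z ∈ openTri u v w) :
    (x = u ∧ y = v) ∨ (x = v ∧ y = w) ∨ (x = w ∧ y = u) := by
  refine hD.edge_of_ray hf.1 hf' hz.1 fun t h0 h1 => ?_
  refine hf'.subset_openTri (convex_openTri x y k).isPreconnected hf.2.2.2.2 ⟨z, hz, hz'⟩ ?_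
  have e1 := orient_rotate x y k
  have e2 := orient_rotate y k x
  have h4 := hf.2.2.2.1
  have hs : 0 ≤ 1 - t := by linarith
  simp only [openTri, Set.mem_ofPred_eq, orient_combo _ _ _ _ (show 1 - t + t = 1 by ring),
    orient_mid, orient_self_left, orient_self_right, e1, e2] at hz ⊢
  obtain ⟨z1, z2, z3⟩ := hz
  have q1 := mul_pos h0 z1
  have q2 := mul_pos h0 z2
  have q3 := mul_pos h0 z3
  have q4 := mul_nonneg hs h4.le
  refine ⟨?_, ?_, ?_⟩ <;> linarith

theorem exists_halfDisc (hD : IsPlaneTriangulation D) {x y : Pt} (hxy : (x, y) ∈ D) :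
    ∃ δ > 0, ∀ z ∈ Metric.ball (mid x y) δ, 0 < orient x y z →
      ∀ e ∈ D, z ∉ segment ℝ e.1 e.2 := by
  let S : Set D := {e | ({e.1.1, e.1.2} : Set Pt) ≠ {x, y}}
  have hcl : IsClosed (⋃ e : S, segment ℝ e.1.1.1 e.1.1.2) := by
    refine (hD.locallyFinite.comp_injective (g := ((↑) : S → D))
      Subtype.val_injective).isClosed_iUnion fun e => ?_
    change IsClosed (segment ℝ e.1.1.1 e.1.1.2)
    rw [← convexHull_pair]
    exact (Set.toFinite _).isClosed_convexHull ℝ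
  have hm : mid x y ∈ (⋃ e : S, segment ℝ e.1.1.1 e.1.1.2)ᶜ := by
    simp only [Set.mem_compl_iff, Set.mem_iUnion, not_exists]
    rintro ⟨⟨⟨u, v⟩, huv⟩, hne⟩ hmem
    rcases hD.eq_or_swap_of_mid_mem hxy huv hmem with ⟨rfl, rfl⟩ | ⟨rfl, rfl⟩
    · exact hne rfl
    · exact hne (Set.pair_comm _ _)
  obtain ⟨δ, hδ, hball⟩ := Metric.isOpen_iff.1 hcl.isOpen_compl _ hm
  refine ⟨δ, hδ, fun z hz hpos e he hmem => ?_⟩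
  by_cases hpair : ({e.1, e.2} : Set Pt) = {x, y}
  · have : segment ℝ e.1 e.2 = segment ℝ x y := by
      rw [← convexHull_pair, ← convexHull_pair, hpair]
    rw [this] at hmem
    obtain ⟨s, t, hs, ht, hst, rfl⟩ := hmem
    rw [orient_combo _ _ _ _ hst, orient_self_left, orient_self_right] at hpos
    simp at hpos
  · exact hball hz (Set.mem_iUnion.2 ⟨⟨⟨e, he⟩, hpair⟩, hmem⟩)

theorem exists_face_of_notMem (hD : IsPlaneTriangulation D) {z : Pt}
    (hz : ∀ e ∈ D, z ∉ segment ℝ e.1 e.2) : ∃ u v w, IsFace D u v w ∧ z ∈ openTri u v w := by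
  obtain ⟨u, v, w, h1, h2, h3, hin, hempty⟩ := hD.triangle z hz
  rcases le_total 0 (orient u v w) with h | h
  · obtain ⟨hp, hmem⟩ := mem_openTri_of_mem_interior (hD.ne h1) (hD.ne h2) (hD.ne h3) h hin
    exact ⟨u, v, w, ⟨h1, h2, h3, hp, fun y hy => hempty y (openTri_subset_interior hp hy)⟩, hmem⟩
  · have hset : ({v, u, w} : Set Pt) = {u, v, w} := by ext; simp; tauto
    rw [← hset] at hin hempty
    obtain ⟨hp, hmem⟩ := mem_openTri_of_mem_interior (hD.ne h1).symm (hD.ne h3).symm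
      (hD.ne h2).symm (by rw [orient_swap]; linarith) hin
    exact ⟨v, u, w, ⟨hD.symm h1, hD.symm h3, hD.symm h2, hp,
      fun y hy => hempty y (openTri_subset_interior hp hy)⟩, hmem⟩

/-- Every directed edge has a face on its left. -/
theorem exists_face (hD : IsPlaneTriangulation D) {x y : Pt} (hxy : (x, y) ∈ D) :
    ∃ w, IsFace D x y w := by
  obtain ⟨δ, hδ, hdisc⟩ := hD.exists_halfDisc hxy
  obtain ⟨s, hs, hmem⟩ := exists_small_add_smul_mem (Metric.ball_mem_nhds (mid x y) hδ)
    (!₂[-(y 1 - x 1), y 0 - x 0] : Pt)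
  have hzb := hmem s (abs_of_pos hs).le
  have hzo := orient_add_perp x y (mid x y) s
  generalize mid x y + s • (!₂[-(y 1 - x 1), y 0 - x 0] : Pt) = z at hzb hzo
  have hm0 : orient x y (mid x y) = 0 := by
    rw [orient_mid, orient_self_left, orient_self_right]; simp
  have hzpos : 0 < orient x y z := by
    rw [hzo, hm0, zero_add]
    exact mul_pos hs (sq_dist_pos (hD.ne hxy))
  obtain ⟨u, v, w, hf, hz⟩ := hD.exists_face_of_notMem (hdisc z hzb hzpos)
  have hconv : Convex ℝ (Metric.ball (mid x y) δ ∩ {z | 0 < orient x y z}) :=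
    (convex_ball _ _).inter (convex_orient_pos x y)
  have hsub := hf.subset_openTri hconv.isPreconnected (fun y hy => hdisc y hy.1 hy.2)
    ⟨z, ⟨hzb, hzpos⟩, hz⟩
  have hedge := hD.edge_of_ray hxy hf hzpos fun t h0 h1 => by
    refine hsub ⟨convex_ball _ _ (Metric.mem_ball_self hδ) hzb (by linarith) h0.le (by ring), ?_⟩
    rw [Set.mem_ofPred_eq, orient_combo _ _ _ _ (by ring), hm0, mul_zero, zero_add]
    exact mul_pos h0 hzpos
  rcases hedge with ⟨rfl, rfl⟩ | ⟨rfl, rfl⟩ | ⟨rfl, rfl⟩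
  · exact ⟨w, hf⟩
  · exact ⟨u, hf.rotate⟩
  · exact ⟨v, hf.rotate.rotate⟩

/-- The face on the left of a directed edge is unique. -/
theorem face_unique (hD : IsPlaneTriangulation D) {x y w w' : Pt} (hf : IsFace D x y w)
    (hf' : IsFace D x y w') : w = w' := by
  have hmid : ∀ k, IsFace D x y k → 0 < orient y k (mid x y) ∧ 0 < orient k x (mid x y) := by
    intro k hk
    have e1 := orient_rotate x y k
    have e2 := orient_rotate y k x
    rw [orient_mid, orient_mid, orient_self_left, orient_self_right, e1, e2]
    constructor <;> linarith [hk.2.2.2.1]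
  have hopen : IsOpen {z | (0 < orient y w z ∧ 0 < orient w x z) ∧
      (0 < orient y w' z ∧ 0 < orient w' x z)} :=
    ((isOpen_lt continuous_const (continuous_orient _ _)).inter
      (isOpen_lt continuous_const (continuous_orient _ _))).inter
    ((isOpen_lt continuous_const (continuous_orient _ _)).inter
      (isOpen_lt continuous_const (continuous_orient _ _)))
  obtain ⟨s, hs, hmem⟩ := exists_small_add_smul_mem
    (hopen.mem_nhds ⟨hmid w hf, hmid w' hf'⟩) (!₂[-(y 1 - x 1), y 0 - x 0] : Pt)
  have hz := hmem s (abs_of_pos hs).le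
  have hzo := orient_add_perp x y (mid x y) s
  generalize mid x y + s • (!₂[-(y 1 - x 1), y 0 - x 0] : Pt) = z at hz hzo
  have hpos : 0 < orient x y z := by
    rw [hzo, orient_mid, orient_self_left, orient_self_right]
    simpa using mul_pos hs (sq_dist_pos (hD.ne hf.1))
  have hover : z ∈ openTri y w x := by
    rw [openTri_rotate]; exact ⟨hpos, hz.1⟩
  rcases hD.edge_of_overlap hf.rotate hf' hover ⟨hpos, hz.2⟩ with h | h | h
  · exact absurd h.1.symm (hD.ne hf.1)
  · exact h.2
  · exact absurd h.1 (hD.ne hf'.2.1)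

/-- The faces of a plane triangulation are connected through edges: a property of directed edges
which is invariant under moving along a face and under reversal holds for all edges as soon as it
holds for one. -/
theorem edge_induction (hD : IsPlaneTriangulation D) {P : Pt → Pt → Prop}
    (hface : ∀ u v w, IsFace D u v w → P u v → P v w)
    (hrev : ∀ u v, (u, v) ∈ D → P u v → P v u)
    {x₀ y₀ : Pt} (h₀ : (x₀, y₀) ∈ D) (hP₀ : P x₀ y₀) {x y : Pt} (hxy : (x, y) ∈ D) : P x y := by
  by_contra hP
  let X : Set Pt := (Prod.fst '' D)ᶜ
  have hX : IsPreconnected X := by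
    refine ((hD.countable.image _).isConnected_compl_of_one_lt_rank ?_).isPreconnected
    rw [← Module.finrank_eq_rank]
    simp
  let U : (Pt → Pt → Prop) → Set Pt := fun Q => {z | ∃ u v w w', IsFace D u v w ∧ IsFace D v u w' ∧
    Q u v ∧ (z ∈ openTri u v w ∨ ((0 < orient v w z ∧ 0 < orient w u z) ∧
      (0 < orient u w' z ∧ 0 < orient w' v z)))}
  have hU : ∀ Q, IsOpen (U Q) := by
    intro Q
    rw [isOpen_iff_mem_nhds]
    rintro z ⟨u, v, w, w', hf, hf', hQ, hz⟩
    have hopen : IsOpen (openTri u v w ∪ {z | (0 < orient v w z ∧ 0 < orient w u z) ∧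
        (0 < orient u w' z ∧ 0 < orient w' v z)}) :=
      (isOpen_openTri u v w).union
      (((isOpen_lt continuous_const (continuous_orient _ _)).inter
        (isOpen_lt continuous_const (continuous_orient _ _))).inter
      ((isOpen_lt continuous_const (continuous_orient _ _)).inter
        (isOpen_lt continuous_const (continuous_orient _ _))))
    filter_upwards [hopen.mem_nhds hz] with y hy
    exact ⟨u, v, w, w', hf, hf', hQ, hy⟩
  have hUmem : ∀ Q : Pt → Pt → Prop, (∀ u v, (u, v) ∈ D → Q u v → Q v u) → ∀ z ∈ U Q,
      (∃ u v w, IsFace D u v w ∧ Q u v ∧ z ∈ openTri u v w) ∨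
      (∃ u v, (u, v) ∈ D ∧ Q u v ∧ z ∈ segment ℝ u v) := by
    rintro Q hQs z ⟨u, v, w, w', hf, hf', hQ, hz | ⟨hz, hz'⟩⟩
    · exact Or.inl ⟨u, v, w, hf, hQ, hz⟩
    · rcases lt_trichotomy (orient u v z) 0 with h | h | h
      · exact Or.inl ⟨v, u, w', hf', hQs _ _ hf.1 hQ, by rw [orient_swap]; linarith, hz'⟩
      · exact Or.inr ⟨u, v, hf.1, hQ, mem_segment_of_orient hf.2.2.2.1 h hz.1.le hz.2.le⟩
      · exact Or.inl ⟨u, v, w, hf, hQ, h, hz⟩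
  have hrev' : ∀ u v, (u, v) ∈ D → ¬ P u v → ¬ P v u := fun u v h hn hp =>
    hn (hrev _ _ (hD.symm h) hp)
  have hdisj : X ∩ (U P ∩ U fun u v => ¬ P u v) = ∅ := by
    rw [Set.eq_empty_iff_forall_notMem]
    rintro z ⟨hzX, hz1, hz2⟩
    rcases hUmem P hrev z hz1 with ⟨u, v, w, hf, hQ, hz⟩ | ⟨u, v, huv, hQ, hz⟩ <;>
    rcases hUmem _ hrev' z hz2 with ⟨u', v', w', hf', hQ', hz'⟩ | ⟨u', v', huv', hQ', hz'⟩
    · apply hQ'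
      have h1 := hface _ _ _ hf hQ
      have h2 := hface _ _ _ hf.rotate h1
      rcases hD.edge_of_overlap hf' hf hz' hz with ⟨rfl, rfl⟩ | ⟨rfl, rfl⟩ | ⟨rfl, rfl⟩ <;>
        assumption
    · exact hf.2.2.2.2 _ hz _ huv' hz'
    · exact hf'.2.2.2.2 _ hz' _ huv hz
    · by_cases hpair : ({u, v} : Set Pt) = {u', v'}
      · rcases eq_or_swap_of_pair_eq hpair with ⟨rfl, rfl⟩ | ⟨rfl, rfl⟩
        · exact hQ' hQ
        · exact hQ' (hrev _ _ huv hQ)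
      · rcases (hD.cross _ huv _ huv' hpair ⟨hz, hz'⟩).1 with h | h
        · exact hzX ⟨_, huv, h.symm⟩
        · exact hzX ⟨_, hD.symm huv, h.symm⟩
  have hcover : X ⊆ U P ∪ U fun u v => ¬ P u v := by
    intro z hzX
    have hP_or : ∀ u v w w', IsFace D u v w → IsFace D v u w' →
        (z ∈ openTri u v w ∨ ((0 < orient v w z ∧ 0 < orient w u z) ∧
          (0 < orient u w' z ∧ 0 < orient w' v z))) → z ∈ U P ∪ U fun u v => ¬ P u v := by
      intro u v w w' hf hf' hz
      by_cases hQ : P u v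
      · exact Or.inl ⟨u, v, w, w', hf, hf', hQ, hz⟩
      · exact Or.inr ⟨u, v, w, w', hf, hf', hQ, hz⟩
    by_cases hz : ∀ e ∈ D, z ∉ segment ℝ e.1 e.2
    · obtain ⟨u, v, w, hf, hmem⟩ := hD.exists_face_of_notMem hz
      obtain ⟨w', hf'⟩ := hD.exists_face (hD.symm hf.1)
      exact hP_or u v w w' hf hf' (Or.inl hmem)
    · push Not at hz
      obtain ⟨⟨u, v⟩, huv, hmem⟩ := hz
      obtain ⟨w, hf⟩ := hD.exists_face huv
      obtain ⟨w', hf'⟩ := hD.exists_face (hD.symm huv)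
      refine hP_or u v w w' hf hf' (Or.inr ?_)
      obtain ⟨s, t, hs, ht, hst, rfl⟩ := hmem
      have hs' : 0 < s := by
        rcases hs.eq_or_lt with rfl | h
        · obtain rfl : t = 1 := by linarith
          exact absurd ⟨_, hD.symm huv, by simp⟩ hzX
        · exact h
      have ht' : 0 < t := by
        rcases ht.eq_or_lt with rfl | h
        · obtain rfl : s = 1 := by linarith
          exact absurd ⟨_, huv, by simp⟩ hzX
        · exact h
      have a1 := hf.2.2.2.1
      have a2 := hf'.2.2.2.1
      simp only [orient_combo _ _ _ _ hst, orient_self_left, orient_self_right, mul_zero, zero_add,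
        add_zero, orient_rotate u v w, ← orient_rotate w u v, orient_rotate v u w',
        ← orient_rotate w' v u]
      refine ⟨⟨mul_pos hs' a1, mul_pos ht' a1⟩, mul_pos ht' a2, mul_pos hs' a2⟩
  have hpoint : ∀ Q : Pt → Pt → Prop, ∀ u v, (u, v) ∈ D → Q u v → ∃ z ∈ X, z ∈ U Q := by
    intro Q u v huv hQ
    obtain ⟨w, hf⟩ := hD.exists_face huv
    obtain ⟨w', hf'⟩ := hD.exists_face (hD.symm huv)
    obtain ⟨z, hz⟩ := openTri_nonempty hf.2.2.2.1
    refine ⟨z, ?_, u, v, w, w', hf, hf', hQ, Or.inl hz⟩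
    rintro ⟨e, he, rfl⟩
    exact hf.2.2.2.2 _ hz _ he (left_mem_segment ℝ _ _)
  obtain ⟨z₁, hz₁X, hz₁⟩ := hpoint P _ _ h₀ hP₀
  obtain ⟨z₂, hz₂X, hz₂⟩ := hpoint (fun u v => ¬ P u v) _ _ hxy hP
  rcases isPreconnected_iff_subset_of_disjoint.1 hX _ _ (hU P) (hU _) hcover hdisj with h | h
  · exact Set.eq_empty_iff_forall_notMem.1 hdisj z₂ ⟨hz₂X, h hz₂X, hz₂⟩
  · exact Set.eq_empty_iff_forall_notMem.1 hdisj z₁ ⟨hz₁X, hz₁, h hz₁X⟩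

end IsPlaneTriangulation

theorem lvec_apply_zero (a b : ℝ) (z : ℤ × ℤ) : lvec a b z 0 = z.1 * a + z.2 * b := by
  simp [lvec, vec]

theorem lvec_apply_one (a b : ℝ) (z : ℤ × ℤ) : lvec a b z 1 = z.2 * (1 / a) := by
  simp [lvec, vec]

theorem lvec_add (a b : ℝ) (z w : ℤ × ℤ) : lvec a b (z + w) = lvec a b z + lvec a b w := by
  simp only [lvec, Prod.fst_add, Prod.snd_add, Int.cast_add, add_smul]
  abel

theorem lvec_zero (a b : ℝ) : lvec a b 0 = 0 := by simp [lvec]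

theorem lvec_sub (a b : ℝ) (z w : ℤ × ℤ) : lvec a b (z - w) = lvec a b z - lvec a b w := by
  rw [eq_sub_iff_add_eq, ← lvec_add, sub_add_cancel]

theorem lvec_mem_latAB (a b : ℝ) (z : ℤ × ℤ) : lvec a b z ∈ latAB a b := ⟨z.1, z.2, rfl⟩

theorem lvec_eq_zero {a b : ℝ} (ha : 0 < a) {z : ℤ × ℤ} (h : lvec a b z = 0) : z = 0 := by
  have h0 := lvec_apply_zero a b z
  have h1 := lvec_apply_one a b z
  rw [h] at h0 h1
  have hz2 : (z.2 : ℝ) = 0 := by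
    rcases mul_eq_zero.1 h1.symm with h | h
    · exact h
    · exact absurd h (one_div_pos.2 ha).ne'
  rw [hz2, zero_mul, add_zero] at h0
  have hz1 : (z.1 : ℝ) = 0 := (mul_eq_zero.1 h0.symm).resolve_right ha.ne'
  exact Prod.ext (by exact_mod_cast hz1) (by exact_mod_cast hz2)

theorem finite_lvec_norm_le {a : ℝ} (ha : 0 < a) (b R : ℝ) :
    {m : ℤ × ℤ | ‖lvec a b m‖ ≤ R}.Finite := by
  refine ((Set.finite_Icc (-⌈(R + a * R * |b|) / a⌉) ⌈(R + a * R * |b|) / a⌉).prod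
    (Set.finite_Icc (-⌈a * R⌉) ⌈a * R⌉)).subset fun m hm => ?_
  have h0 : ‖lvec a b m 0‖ ≤ R := (PiLp.norm_apply_le _ 0).trans hm
  have h1 : ‖lvec a b m 1‖ ≤ R := (PiLp.norm_apply_le _ 1).trans hm
  rw [lvec_apply_zero, Real.norm_eq_abs] at h0
  rw [lvec_apply_one, Real.norm_eq_abs, abs_mul, abs_of_pos (one_div_pos.2 ha), mul_one_div,
    div_le_iff₀ ha] at h1
  have h2 : |(m.2 : ℝ)| ≤ a * R := by linarith
  have h3 : |(m.1 : ℝ)| ≤ (R + a * R * |b|) / a := by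
    rw [le_div_iff₀ ha]
    calc |(m.1 : ℝ)| * a = |(m.1 * a + m.2 * b) - m.2 * b| := by
          rw [add_sub_cancel_right, abs_mul, abs_of_pos ha]
      _ ≤ |m.1 * a + m.2 * b| + |m.2 * b| := abs_sub _ _
      _ ≤ R + a * R * |b| := by
          rw [abs_mul]
          exact add_le_add h0 (mul_le_mul_of_nonneg_right h2 (abs_nonneg _))
  have key : ∀ (k : ℤ) (x : ℝ), |(k : ℝ)| ≤ x → k ∈ Set.Icc (-⌈x⌉) ⌈x⌉ := by
    intro k x hk
    have : |(k : ℝ)| ≤ (⌈x⌉ : ℝ) := hk.trans (Int.le_ceil x)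
    exact abs_le.1 (by exact_mod_cast this)
  exact ⟨key _ _ h3, key _ _ h2⟩

/-- The translate of the `i`-th vertex by the lattice vector with coordinates `m`. -/
def lift (a b : ℝ) {n : ℕ} (p : Fin n → Pt) (i : Fin n) (m : ℤ × ℤ) : Pt := p i + lvec a b m

theorem lift_add (a b : ℝ) {n : ℕ} (p : Fin n → Pt) (i : Fin n) (m k : ℤ × ℤ) :
    lift a b p i (m + k) = lift a b p i m + lvec a b k := by
  rw [lift, lift, lvec_add, add_assoc]

theorem lift_inj {a b : ℝ} (ha : 0 < a) {n : ℕ} {p : Fin n → Pt} {r : Fin n → ℝ}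
    (hpack : IsPacking (latAB a b) p r) {i j : Fin n} {m k : ℤ × ℤ}
    (h : lift a b p i m = lift a b p j k) : i = j ∧ m = k := by
  have h0 : p i - p j + lvec a b (m - k) = 0 := by
    rw [lvec_sub]
    unfold lift at h
    rw [← sub_eq_zero] at h
    rw [← h]; abel
  by_cases hc : j = i ∧ lvec a b (m - k) = 0
  · exact ⟨hc.1.symm, sub_eq_zero.1 (lvec_eq_zero ha hc.2)⟩
  · have := hpack.2 i j _ (lvec_mem_latAB a b _) hc
    rw [h0, norm_zero] at this
    linarith [hpack.1 i, hpack.1 j]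

theorem mem_planeSegs {a b : ℝ} {n : ℕ} {p : Fin n → Pt} {E : Finset (Fin n × Fin n × ℤ × ℤ)}
    {x y : Pt} : (x, y) ∈ planeSegs a b p E ↔
      ∃ c ∈ E, ∃ m, x = lift a b p c.1 m ∧ y = lift a b p c.2.1 (m - c.2.2) := by
  have key : ∀ (c : Fin n × Fin n × ℤ × ℤ) (m : ℤ × ℤ),
      p c.2.1 - lvec a b c.2.2 + lvec a b m = lift a b p c.2.1 (m - c.2.2) := by
    intro c m
    rw [lift, lvec_sub]; abel
  simp only [planeSegs, Set.mem_ofPred_eq, Prod.mk.injEq, key, lift]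

theorem isPlaneTriangulation_planeSegs {a b : ℝ} (ha : 0 < a) {n : ℕ} {p : Fin n → Pt}
    {E : Finset (Fin n × Fin n × ℤ × ℤ)} (htri : IsGeodesicTriangulationZ a b p E) :
    IsPlaneTriangulation (planeSegs a b p E) where
  symm := by
    intro u v h
    obtain ⟨c, hc, m, rfl, rfl⟩ := mem_planeSegs.1 h
    exact mem_planeSegs.2 ⟨_, (htri.1 c hc).1, m - c.2.2, rfl, by simp⟩
  ne := by
    rintro u v ⟨c, hc, m, h⟩ huv
    obtain ⟨rfl, rfl⟩ := Prod.mk.inj h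
    exact (htri.1 c hc).2 (add_right_cancel huv)
  countable := by
    refine (Set.countable_range fun x : (Fin n × Fin n × ℤ × ℤ) × ℤ × ℤ =>
      (p x.1.1 + lvec a b x.2, p x.1.2.1 - lvec a b x.1.2.2 + lvec a b x.2)).mono ?_
    rintro e ⟨c, -, m, rfl⟩
    exact ⟨(c, m), rfl⟩
  locallyFinite := by
    intro x
    refine ⟨Metric.ball x 1, Metric.ball_mem_nhds x one_pos, ?_⟩
    have hfin : (⋃ c ∈ E, (fun m => ((p c.1 + lvec a b m,
        p c.2.1 - lvec a b c.2.2 + lvec a b m) : Pt × Pt)) ''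
        {m | ‖lvec a b m‖ ≤ ‖x‖ + 1 + (‖p c.1‖ + ‖p c.2.1 - lvec a b c.2.2‖)}).Finite :=
      E.finite_toSet.biUnion fun c _ => (finite_lvec_norm_le ha b _).image _
    refine (hfin.preimage (f := Subtype.val) Subtype.val_injective.injOn).subset ?_
    rintro ⟨e, he⟩ ⟨z, hz, hzx⟩
    obtain ⟨c, hc, m, rfl⟩ := he
    refine Set.mem_biUnion hc ⟨m, ?_, rfl⟩
    obtain ⟨s, t, hs, ht, hst, rfl⟩ := hz
    obtain rfl : s = 1 - t := by linarith
    rw [Metric.mem_ball, dist_eq_norm] at hzx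
    set y := p c.2.1 - lvec a b c.2.2
    have e : lvec a b m = x + ((1 - t) • (p c.1 + lvec a b m) + t • (y + lvec a b m) - x)
        - ((1 - t) • p c.1 + t • y) := by module
    have h1 : ‖(1 - t) • p c.1‖ ≤ ‖p c.1‖ := by
      rw [norm_smul, Real.norm_eq_abs, abs_of_nonneg hs]
      exact mul_le_of_le_one_left (norm_nonneg _) (by linarith)
    have h2 : ‖t • y‖ ≤ ‖y‖ := by
      rw [norm_smul, Real.norm_eq_abs, abs_of_nonneg ht]
      exact mul_le_of_le_one_left (norm_nonneg _) (by linarith)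
    rw [Set.mem_ofPred_eq, e]
    refine (norm_sub_le _ _).trans (add_le_add ((norm_add_le _ _).trans ?_)
      ((norm_add_le _ _).trans (add_le_add h1 h2)))
    exact add_le_add le_rfl hzx.le
  cross := htri.2.2.1
  triangle := htri.2.2.2

theorem mem_segment_sub {x u v t : Pt} (h : x ∈ segment ℝ u v) :
    x - t ∈ segment ℝ (u - t) (v - t) := by
  obtain ⟨s, s', hs, hs', hss, rfl⟩ := h
  obtain rfl : s = 1 - s' := by linarith
  exact ⟨1 - s', s', hs, hs', hss, by module⟩

theorem IsFace.translate {D : Set (Pt × Pt)} {t : Pt}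
    (h₁ : ∀ u v, (u, v) ∈ D → (u + t, v + t) ∈ D) (h₂ : ∀ u v, (u, v) ∈ D → (u - t, v - t) ∈ D)
    {u v w : Pt} (hf : IsFace D u v w) : IsFace D (u + t) (v + t) (w + t) := by
  obtain ⟨f1, f2, f3, f4, f5⟩ := hf
  refine ⟨h₁ _ _ f1, h₁ _ _ f2, h₁ _ _ f3, by rwa [orient_add_left], fun y hy e he hye => ?_⟩
  refine f5 (y - t) ?_ _ (h₂ _ _ he) (mem_segment_sub hye)
  have := hy
  rw [← sub_add_cancel y t] at this
  simpa only [openTri, Set.mem_ofPred_eq, orient_add_left] using this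

theorem add_lvec_mem_planeSegs {a b : ℝ} {n : ℕ} {p : Fin n → Pt}
    {E : Finset (Fin n × Fin n × ℤ × ℤ)} (k : ℤ × ℤ) {u v : Pt}
    (h : (u, v) ∈ planeSegs a b p E) : (u + lvec a b k, v + lvec a b k) ∈ planeSegs a b p E := by
  obtain ⟨c, hc, m, rfl, rfl⟩ := mem_planeSegs.1 h
  exact mem_planeSegs.2 ⟨c, hc, m + k, (lift_add _ _ _ _ _ _).symm, by
    rw [← lift_add]; congr 1; abel⟩

/-- The directed edges `c, c', c''` of the torus bound, in this order, a face of the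
triangulation. -/
def IsTorusFace (a b : ℝ) {n : ℕ} (p : Fin n → Pt) (E : Finset (Fin n × Fin n × ℤ × ℤ))
    (c c' c'' : Fin n × Fin n × ℤ × ℤ) : Prop :=
  (c ∈ E ∧ c' ∈ E ∧ c'' ∈ E) ∧ (c'.1 = c.2.1 ∧ c''.1 = c'.2.1 ∧ c''.2.1 = c.1) ∧
  c.2.2 + c'.2.2 + c''.2.2 = 0 ∧
  ∀ m, IsFace (planeSegs a b p E) (lift a b p c.1 m) (lift a b p c.2.1 (m - c.2.2))
    (lift a b p c'.2.1 (m - c.2.2 - c'.2.2))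

section Torus

variable {a b : ℝ} {n : ℕ} {p : Fin n → Pt} {r : Fin n → ℝ} {E : Finset (Fin n × Fin n × ℤ × ℤ)}

theorem IsTorusFace.rotate {c c' c'' : Fin n × Fin n × ℤ × ℤ}
    (h : IsTorusFace a b p E c c' c'') : IsTorusFace a b p E c' c'' c := by
  obtain ⟨⟨h1, h2, h3⟩, ⟨e1, e2, e3⟩, hz, hf⟩ := h
  refine ⟨⟨h2, h3, h1⟩, ⟨e2, e3.symm, e1.symm⟩, by rw [← hz]; abel, fun m => ?_⟩
  have := (hf (m + c.2.2)).rotate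
  rw [add_sub_cancel_right] at this
  have hm : m - c'.2.2 - c''.2.2 = m + c.2.2 := by
    rw [← sub_eq_zero, ← neg_eq_zero, ← hz]; abel
  rwa [e1, e3, hm]

theorem exists_torusFace (ha : 0 < a) (hpack : IsPacking (latAB a b) p r)
    (htri : IsGeodesicTriangulationZ a b p E) {c : Fin n × Fin n × ℤ × ℤ} (hc : c ∈ E) :
    ∃ c' c'', IsTorusFace a b p E c c' c'' := by
  obtain ⟨w, hf⟩ := (isPlaneTriangulation_planeSegs ha htri).exists_face
    (mem_planeSegs.2 ⟨c, hc, 0, rfl, rfl⟩)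
  obtain ⟨c', hc', m', h1, rfl⟩ := mem_planeSegs.1 hf.2.1
  obtain ⟨c'', hc'', m'', h2, h3⟩ := mem_planeSegs.1 hf.2.2.1
  obtain ⟨e1, rfl⟩ := lift_inj ha hpack h1
  obtain ⟨e2, rfl⟩ := lift_inj ha hpack h2
  obtain ⟨e3, hz⟩ := lift_inj ha hpack h3
  refine ⟨c', c'', ⟨hc, hc', hc''⟩, ⟨e1.symm, e2.symm, e3.symm⟩, ?_, fun m => ?_⟩
  · rw [← neg_eq_zero, hz]; abel
  · have := hf.translate (t := lvec a b m) (fun u v h => add_lvec_mem_planeSegs m h)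
      (fun u v h => by
        have := add_lvec_mem_planeSegs (-m) h
        rwa [← zero_sub, lvec_sub, lvec_zero, zero_sub, ← sub_eq_add_neg, ← sub_eq_add_neg] at this)
    simp only [← lift_add] at this
    convert this using 2 <;> abel

theorem torusFace_unique (ha : 0 < a) (hpack : IsPacking (latAB a b) p r)
    (htri : IsGeodesicTriangulationZ a b p E) {c c' c'' d' d'' : Fin n × Fin n × ℤ × ℤ}
    (h : IsTorusFace a b p E c c' c'') (h' : IsTorusFace a b p E c d' d'') :
    c' = d' ∧ c'' = d'' := by
  obtain ⟨e, hz⟩ := lift_inj ha hpack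
    ((isPlaneTriangulation_planeSegs ha htri).face_unique (h.2.2.2 0) (h'.2.2.2 0))
  rw [sub_right_inj] at hz
  obtain ⟨-, ⟨e1, e2, e3⟩, s, -⟩ := h
  obtain ⟨-, ⟨f1, f2, f3⟩, t, -⟩ := h'
  rw [← t, hz, add_right_inj] at s
  exact ⟨Prod.ext (e1.trans f1.symm) (Prod.ext e hz),
    Prod.ext (e2.trans (e.trans f2.symm)) (Prod.ext (e3.trans f3.symm) s)⟩

theorem torus_edge_induction (ha : 0 < a) (hpack : IsPacking (latAB a b) p r)
    (htri : IsGeodesicTriangulationZ a b p E) {P : Fin n × Fin n × ℤ × ℤ → ℤ × ℤ → Prop}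
    (hface : ∀ c c' c'' m, IsTorusFace a b p E c c' c'' → P c m → P c' (m - c.2.2))
    (hrev : ∀ c ∈ E, ∀ m, P c m → P (c.2.1, c.1, -c.2.2) (m - c.2.2))
    {c₀ : Fin n × Fin n × ℤ × ℤ} (hc₀ : c₀ ∈ E) {m₀ : ℤ × ℤ} (h₀ : P c₀ m₀) :
    ∀ c ∈ E, ∀ m, P c m := by
  have hD := isPlaneTriangulation_planeSegs ha htri
  have key : ∀ c ∈ E, ∀ m, ∀ d ∈ E, ∀ k, lift a b p c.1 m = lift a b p d.1 k →
      lift a b p c.2.1 (m - c.2.2) = lift a b p d.2.1 (k - d.2.2) → c = d ∧ m = k := by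
    intro c _ m d _ k h1 h2
    obtain ⟨e1, rfl⟩ := lift_inj ha hpack h1
    obtain ⟨e2, h⟩ := lift_inj ha hpack h2
    exact ⟨Prod.ext e1 (Prod.ext e2 (sub_right_inj.1 h)), rfl⟩
  intro c hc m
  refine hD.edge_induction (P := fun x y => ∀ c ∈ E, ∀ m, x = lift a b p c.1 m →
    y = lift a b p c.2.1 (m - c.2.2) → P c m) ?_ ?_ (mem_planeSegs.2 ⟨c₀, hc₀, m₀, rfl, rfl⟩) ?_
    (mem_planeSegs.2 ⟨c, hc, m, rfl, rfl⟩) c hc m rfl rfl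
  · intro u v w hf hP d hd k hv hw
    obtain ⟨c, hc, m, rfl, rfl⟩ := mem_planeSegs.1 hf.1
    obtain ⟨c', c'', ht⟩ := exists_torusFace ha hpack htri hc
    obtain rfl := hD.face_unique hf (ht.2.2.2 m)
    obtain ⟨rfl, rfl⟩ := key c' ht.1.2.1 (m - c.2.2) d hd k (by rw [ht.2.1.1, hv]) hw
    exact hface _ _ _ _ ht (hP c hc m rfl rfl)
  · intro u v huv hP d hd k hv hu
    obtain ⟨c, hc, m, rfl, rfl⟩ := mem_planeSegs.1 huv
    obtain ⟨rfl, rfl⟩ := key (c.2.1, c.1, -c.2.2) (htri.1 c hc).1 (m - c.2.2) d hd k hv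
      (by rw [← hu]; simp)
    exact hrev c hc m (hP c hc m rfl rfl)
  · intro d hd k h1 h2
    obtain ⟨rfl, rfl⟩ := key c₀ hc₀ m₀ d hd k h1 h2
    exact h₀

end Torus

/-- The horizontal extent of the edge `c` in the lattice spanned by `(a, 0)` and `(b, d)`. -/
def edgeX (a b : ℝ) {n : ℕ} (p : Fin n → Pt) (c : Fin n × Fin n × ℤ × ℤ) : ℝ :=
  p c.2.1 0 - p c.1 0 - (c.2.2.1 * a + c.2.2.2 * b)

/-- The vertical extent of the edge `c` in the lattice spanned by `(a, 0)` and `(b, d)`. -/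
def edgeY (d : ℝ) {n : ℕ} (p : Fin n → Pt) (c : Fin n × Fin n × ℤ × ℤ) : ℝ :=
  p c.2.1 1 - p c.1 1 - c.2.2.2 * d

theorem edgeX_rev (a b : ℝ) {n : ℕ} (p : Fin n → Pt) (c : Fin n × Fin n × ℤ × ℤ) :
    edgeX a b p (c.2.1, c.1, -c.2.2) = -edgeX a b p c := by
  simp only [edgeX, Prod.fst_neg, Prod.snd_neg, Int.cast_neg]; ring

theorem edgeY_rev (d : ℝ) {n : ℕ} (p : Fin n → Pt) (c : Fin n × Fin n × ℤ × ℤ) :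
    edgeY d p (c.2.1, c.1, -c.2.2) = -edgeY d p c := by
  simp only [edgeY, Prod.snd_neg, Int.cast_neg]; ring

section Rigidity

variable {a b : ℝ} {n : ℕ} {p : Fin n → Pt} {r : Fin n → ℝ} {E : Finset (Fin n × Fin n × ℤ × ℤ)}

theorem IsTorusFace.edgeX_add {c c' c'' : Fin n × Fin n × ℤ × ℤ}
    (h : IsTorusFace a b p E c c' c'') (a' b' : ℝ) (q : Fin n → Pt) :
    edgeX a' b' q c + edgeX a' b' q c' + edgeX a' b' q c'' = 0 := by
  obtain ⟨-, ⟨e1, e2, e3⟩, hz, -⟩ := h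
  have h1 : (c.2.2.1 + c'.2.2.1 + c''.2.2.1 : ℝ) = 0 := by exact_mod_cast congrArg Prod.fst hz
  have h2 : (c.2.2.2 + c'.2.2.2 + c''.2.2.2 : ℝ) = 0 := by exact_mod_cast congrArg Prod.snd hz
  unfold edgeX
  rw [e1, e2, e3]
  linear_combination -a' * h1 - b' * h2

theorem IsTorusFace.edgeY_add {c c' c'' : Fin n × Fin n × ℤ × ℤ}
    (h : IsTorusFace a b p E c c' c'') (d : ℝ) (q : Fin n → Pt) :
    edgeY d q c + edgeY d q c' + edgeY d q c'' = 0 := by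
  obtain ⟨-, ⟨e1, e2, e3⟩, hz, -⟩ := h
  have h2 : (c.2.2.2 + c'.2.2.2 + c''.2.2.2 : ℝ) = 0 := by exact_mod_cast congrArg Prod.snd hz
  unfold edgeY
  rw [e1, e2, e3]
  linear_combination -d * h2

theorem IsTorusFace.area_pos {c c' c'' : Fin n × Fin n × ℤ × ℤ}
    (h : IsTorusFace a b p E c c' c'') :
    0 < edgeX a b p c * edgeY (1 / a) p c' - edgeY (1 / a) p c * edgeX a b p c' := by
  have ho := (h.2.2.2 0).2.2.2.1
  have e1 := h.2.1.1
  simp only [orient, lift, PiLp.add_apply, lvec_apply_zero, lvec_apply_one, Prod.fst_sub,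
    Prod.snd_sub, Prod.fst_zero, Prod.snd_zero, Int.cast_sub, Int.cast_zero] at ho
  simp only [edgeX, edgeY, e1]
  linarith

theorem exists_next_edge (ha : 0 < a) (hpack : IsPacking (latAB a b) p r)
    (htri : IsGeodesicTriangulationZ a b p E) :
    ∃ f g : Fin n × Fin n × ℤ × ℤ → Fin n × Fin n × ℤ × ℤ,
      (∀ c ∈ E, IsTorusFace a b p E c (f c) (g c)) ∧
      ∀ F : Fin n × Fin n × ℤ × ℤ → ℝ,
        ∑ c ∈ E, F (f c) = ∑ c ∈ E, F c ∧ ∑ c ∈ E, F (g c) = ∑ c ∈ E, F c := by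
  have H : ∀ c, ∃ d : (Fin n × Fin n × ℤ × ℤ) × (Fin n × Fin n × ℤ × ℤ),
      c ∈ E → IsTorusFace a b p E c d.1 d.2 := by
    intro c
    by_cases hc : c ∈ E
    · obtain ⟨c', c'', h⟩ := exists_torusFace ha hpack htri hc
      exact ⟨(c', c''), fun _ => h⟩
    · exact ⟨(c, c), fun h => absurd h hc⟩
  choose d hd using H
  have hfg : ∀ c ∈ E, (d (d c).1).2 = c := fun c hc =>
    (torusFace_unique ha hpack htri (hd _ (hd c hc).1.2.1) (hd c hc).rotate).2
  have hgf : ∀ c ∈ E, (d (d c).2).1 = c := fun c hc =>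
    (torusFace_unique ha hpack htri (hd _ (hd c hc).1.2.2) (hd c hc).rotate.rotate).1
  refine ⟨fun c => (d c).1, fun c => (d c).2, hd, fun F => ⟨?_, ?_⟩⟩
  · exact Finset.sum_nbij' (fun c => (d c).1) (fun c => (d c).2) (fun c hc => (hd c hc).1.2.1)
      (fun c hc => (hd c hc).1.2.2) hfg hgf fun _ _ => rfl
  · exact Finset.sum_nbij' (fun c => (d c).2) (fun c => (d c).1) (fun c hc => (hd c hc).1.2.2)
      (fun c hc => (hd c hc).1.2.1) hgf hfg fun _ _ => rfl

theorem sum_mul_sub_eq_zero (hsymm : ∀ c ∈ E, (c.2.1, c.1, -c.2.2) ∈ E)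
    {ω : Fin n × Fin n × ℤ × ℤ → ℝ} (hω : ∀ c, ω (c.2.1, c.1, -c.2.2) = ω c) (u : Fin n → ℝ) :
    ∑ c ∈ E, ω c * (u c.2.1 - u c.1) = 0 := by
  have h : ∑ c ∈ E, ω c * (u c.2.1 - u c.1) = ∑ c ∈ E, -(ω c * (u c.2.1 - u c.1)) := by
    refine Finset.sum_nbij' (fun c => (c.2.1, c.1, -c.2.2)) (fun c => (c.2.1, c.1, -c.2.2))
      hsymm hsymm (by simp) (by simp) fun c _ => ?_
    rw [hω]; ring
  rw [Finset.sum_neg_distrib] at h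
  linarith

/-- A first-order variation of the centers, the (logarithmic) radii and the lattice which
preserves the inversive distances of all edges of a triangulation is a similarity. -/
theorem infinitesimal_similarity (ha : 0 < a) (hpack : IsPacking (latAB a b) p r)
    (htri : IsGeodesicTriangulationZ a b p E) {σ : Fin n × Fin n × ℤ × ℤ → ℝ}
    (hσ : ∀ c ∈ E, 0 ≤ σ c)
    (hL : ∀ c ∈ E, edgeX a b p c ^ 2 + edgeY (1 / a) p c ^ 2
      = r c.1 ^ 2 + r c.2.1 ^ 2 + 2 * σ c * r c.1 * r c.2.1)
    {p' : Fin n → Pt} {u : Fin n → ℝ} {a' b' d' : ℝ}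
    (hv : ∀ c ∈ E, edgeX a b p c * edgeX a' b' p' c + edgeY (1 / a) p c * edgeY d' p' c
      = r c.1 ^ 2 * u c.1 + r c.2.1 ^ 2 * u c.2.1 + σ c * r c.1 * r c.2.1 * (u c.1 + u c.2.1))
    (i₀ : Fin n) :
    ∃ ω₀ : ℝ, (∀ i, u i = u i₀) ∧
      ∀ c ∈ E, edgeX a' b' p' c = u i₀ * edgeX a b p c - ω₀ * edgeY (1 / a) p c ∧
        edgeY d' p' c = u i₀ * edgeY (1 / a) p c + ω₀ * edgeX a b p c := by
  set ω : Fin n × Fin n × ℤ × ℤ → ℝ := fun c =>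
    spin (edgeX a b p c) (edgeY (1 / a) p c) (edgeX a' b' p' c) (edgeY d' p' c) with hω
  have hωrev : ∀ c, ω (c.2.1, c.1, -c.2.2) = ω c := fun c => by
    simp only [hω, edgeX_rev, edgeY_rev, spin_neg]
  obtain ⟨f, g, hfg, hsum⟩ := exists_next_edge ha hpack htri
  have htriangle : ∀ c c' c'', IsTorusFace a b p E c c' c'' →
      (¬(u c.1 = u c'.1 ∧ u c'.1 = u c''.1) → ω c * (u c'.1 - u c.1) + ω c' * (u c''.1 - u c'.1)
        + ω c'' * (u c.1 - u c''.1) < 0) ∧ (u c.1 = u c'.1 ∧ u c'.1 = u c''.1 → ω c = ω c') := by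
    intro c c' c'' h
    obtain ⟨h1, h2, h3⟩ := h.1
    obtain ⟨e1, e2, e3⟩ := h.2.1
    have L1 := hL c h1
    have L2 := hL c' h2
    have L3 := hL c'' h3
    have v1 := hv c h1
    have v2 := hv c' h2
    have v3 := hv c'' h3
    rw [← e1] at L1 v1
    rw [← e2] at L2 v2
    rw [e3] at L3 v3
    exact triangle_spin (h.edgeX_add _ _ _) (h.edgeY_add _ _) (h.edgeX_add _ _ _)
      (h.edgeY_add _ _) h.area_pos (hpack.1 _) (hpack.1 _) (hpack.1 _) (hσ _ h1) (hσ _ h2)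
      (hσ _ h3) L1 L2 L3 v1 v2 v3
  set T : Fin n × Fin n × ℤ × ℤ → ℝ := fun c => ω c * (u c.2.1 - u c.1) with hT
  have hTface : ∀ c c' c'', IsTorusFace a b p E c c' c'' → T c + T c' + T c'' =
      ω c * (u c'.1 - u c.1) + ω c' * (u c''.1 - u c'.1) + ω c'' * (u c.1 - u c''.1) := by
    intro c c' c'' h
    simp only [hT, h.2.1.1, h.2.1.2.1, h.2.1.2.2]
  have hle : ∀ c ∈ E, T c + T (f c) + T (g c) ≤ 0 := by
    intro c hc
    by_cases hu : u c.1 = u (f c).1 ∧ u (f c).1 = u (g c).1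
    · rw [hTface _ _ _ (hfg c hc), hu.1, hu.2]
      simp
    · rw [hTface _ _ _ (hfg c hc)]
      exact ((htriangle _ _ _ (hfg c hc)).1 hu).le
  have hTsum : ∑ c ∈ E, (T c + T (f c) + T (g c)) = 0 := by
    rw [Finset.sum_add_distrib, Finset.sum_add_distrib, (hsum T).1, (hsum T).2,
      sum_mul_sub_eq_zero (fun c hc => (htri.1 c hc).1) hωrev u]
    simp
  have hface : ∀ c c' c'', IsTorusFace a b p E c c' c'' → u c.1 = u c'.1 ∧ u c'.1 = u c''.1 := by
    intro c c' c'' h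
    by_contra hu
    have h0 := (Finset.sum_eq_zero_iff_of_nonpos hle).1 hTsum c h.1.1
    obtain ⟨e1, e2⟩ := torusFace_unique ha hpack htri h (hfg c h.1.1)
    rw [← e1, ← e2, hTface _ _ _ h] at h0
    exact ((htriangle _ _ _ h).1 hu).ne h0
  obtain ⟨c₀, hc₀, rfl⟩ := htri.2.1 i₀
  have hu : ∀ c ∈ E, u c.1 = u c₀.1 := fun c hc => by
    refine torus_edge_induction ha hpack htri (P := fun c _ => u c.1 = u c₀.1)
      (fun c c' c'' _ h hc => (hface _ _ _ h).1.symm.trans hc) (fun c hc _ h => ?_) hc₀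
      (m₀ := 0) rfl c hc 0
    obtain ⟨c', c'', ht⟩ := exists_torusFace ha hpack htri hc
    change u c.2.1 = _
    rw [← ht.2.1.1, ← (hface _ _ _ ht).1, h]
  have hω₀ : ∀ c ∈ E, ω c = ω c₀ := fun c hc =>
    torus_edge_induction ha hpack htri (P := fun c _ => ω c = ω c₀)
      (fun c c' c'' _ h hc => ((htriangle _ _ _ h).2 (hface _ _ _ h)).symm.trans hc)
      (fun c _ _ h => (hωrev c).trans h) hc₀ (m₀ := 0) rfl c hc 0
  have hu' : ∀ i, u i = u c₀.1 := fun i => by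
    obtain ⟨c, hc, rfl⟩ := htri.2.1 i
    exact hu c hc
  refine ⟨ω c₀, hu', fun c hc => ?_⟩
  have hpos : 0 < edgeX a b p c ^ 2 + edgeY (1 / a) p c ^ 2 := by
    rw [hL c hc]
    have := hpack.1 c.1
    have := hpack.1 c.2.1
    have := hσ c hc
    positivity
  rw [← hω₀ c hc]
  refine velocity_decomp rfl hpos.ne' ?_
  rw [hv c hc, hL c hc, hu' c.1, hu' c.2.1]
  ring

/-- The periods and the centers follow an infinitesimal similarity of the edges. -/
theorem similarity_of_edges (ha : 0 < a) (hpack : IsPacking (latAB a b) p r)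
    (htri : IsGeodesicTriangulationZ a b p E) {p' : Fin n → Pt} {a' b' d' α ω : ℝ}
    (h : ∀ c ∈ E, edgeX a' b' p' c = α * edgeX a b p c - ω * edgeY (1 / a) p c ∧
        edgeY d' p' c = α * edgeY (1 / a) p c + ω * edgeX a b p c)
    {i₀ : Fin n} (hp : p i₀ = 0) (hp' : p' i₀ = 0) (i : Fin n) (m : ℤ × ℤ) :
    p' i 0 + (m.1 * a' + m.2 * b')
        = α * (p i 0 + (m.1 * a + m.2 * b)) - ω * (p i 1 + m.2 * (1 / a)) ∧
      p' i 1 + m.2 * d' = α * (p i 1 + m.2 * (1 / a)) + ω * (p i 0 + (m.1 * a + m.2 * b)) := by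
  have step : ∀ c ∈ E, ∀ m : ℤ × ℤ,
      (p' c.1 0 + (m.1 * a' + m.2 * b')
        = α * (p c.1 0 + (m.1 * a + m.2 * b)) - ω * (p c.1 1 + m.2 * (1 / a)) ∧
      p' c.1 1 + m.2 * d'
        = α * (p c.1 1 + m.2 * (1 / a)) + ω * (p c.1 0 + (m.1 * a + m.2 * b))) →
      (p' c.2.1 0 + ((m - c.2.2).1 * a' + (m - c.2.2).2 * b')
        = α * (p c.2.1 0 + ((m - c.2.2).1 * a + (m - c.2.2).2 * b))
          - ω * (p c.2.1 1 + (m - c.2.2).2 * (1 / a)) ∧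
      p' c.2.1 1 + (m - c.2.2).2 * d' = α * (p c.2.1 1 + (m - c.2.2).2 * (1 / a))
          + ω * (p c.2.1 0 + ((m - c.2.2).1 * a + (m - c.2.2).2 * b))) := by
    rintro c hc m ⟨h1, h2⟩
    obtain ⟨e1, e2⟩ := h c hc
    simp only [edgeX, edgeY] at e1 e2
    simp only [Prod.fst_sub, Prod.snd_sub, Int.cast_sub]
    constructor
    · linear_combination h1 + e1
    · linear_combination h2 + e2
  obtain ⟨c, hc, rfl⟩ := htri.2.1 i
  obtain ⟨c₀, hc₀, rfl⟩ := htri.2.1 i₀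
  refine torus_edge_induction ha hpack htri (P := fun c m => p' c.1 0 + (m.1 * a' + m.2 * b')
        = α * (p c.1 0 + (m.1 * a + m.2 * b)) - ω * (p c.1 1 + m.2 * (1 / a)) ∧
      p' c.1 1 + m.2 * d' = α * (p c.1 1 + m.2 * (1 / a)) + ω * (p c.1 0 + (m.1 * a + m.2 * b)))
      (fun c c' c'' m ht hm => ?_) (fun c hc m hm => step c hc m hm) hc₀ (m₀ := 0) ?_ c hc m
  · have := step c ht.1.1 m hm
    rwa [← ht.2.1.1] at this
  · simp [hp, hp']

/-- The linearized rigidity problem has only the trivial solution. -/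
theorem infinitesimal_rigidity (ha : 0 < a) (hpack : IsPacking (latAB a b) p r)
    (htri : IsGeodesicTriangulationZ a b p E) {σ : Fin n × Fin n × ℤ × ℤ → ℝ}
    (hσ : ∀ c ∈ E, 0 ≤ σ c)
    (hL : ∀ c ∈ E, edgeX a b p c ^ 2 + edgeY (1 / a) p c ^ 2
      = r c.1 ^ 2 + r c.2.1 ^ 2 + 2 * σ c * r c.1 * r c.2.1)
    {p' : Fin n → Pt} {u : Fin n → ℝ} {a' b' d' : ℝ}
    (hv : ∀ c ∈ E, edgeX a b p c * edgeX a' b' p' c + edgeY (1 / a) p c * edgeY d' p' c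
      = r c.1 ^ 2 * u c.1 + r c.2.1 ^ 2 * u c.2.1 + σ c * r c.1 * r c.2.1 * (u c.1 + u c.2.1))
    {i₀ : Fin n} (hp : p i₀ = 0) (hp' : p' i₀ = 0) (hdet : a * d' + a' * (1 / a) = 0) :
    p' = 0 ∧ u = 0 ∧ a' = 0 ∧ b' = 0 ∧ d' = 0 := by
  obtain ⟨ω, hu, he⟩ := infinitesimal_similarity ha hpack htri hσ hL hv i₀
  have key := similarity_of_edges ha hpack htri he hp hp'
  obtain ⟨h1, h2⟩ := key i₀ (1, 0)
  obtain ⟨h3, h4⟩ := key i₀ (0, 1)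
  simp only [hp, hp', PiLp.zero_apply, Int.cast_one, Int.cast_zero, one_mul, zero_mul, add_zero,
    zero_add, mul_zero, sub_zero] at h1 h2 h3 h4
  have hω : ω = 0 := (mul_eq_zero.1 h2.symm).resolve_right ha.ne'
  subst hω
  have hα : u i₀ = 0 := by
    rw [h4, h1] at hdet
    field_simp at hdet
    linarith
  rw [hα] at h1 h3 h4
  simp only [zero_mul, sub_zero, add_zero] at h1 h3 h4
  refine ⟨?_, funext fun i => (hu i).trans hα, h1, h3, h4⟩
  ext i j
  have := key i 0
  rw [hα] at this
  simp only [Prod.fst_zero, Prod.snd_zero, Int.cast_zero, zero_mul, sub_zero, add_zero] at this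
  fin_cases j
  · exact this.1
  · exact this.2

end Rigidity

/-- A finite system of equations with injective linearization has locally unique solutions. -/
theorem eventually_eq_of_injective_linearization {X κ : Type*} [NormedAddCommGroup X]
    [NormedSpace ℝ X] [FiniteDimensional ℝ X] [Fintype κ] {F : κ → X → ℝ} {x₀ : X}
    (hF : ∀ k, DifferentiableAt ℝ (F k) x₀)
    (hinj : ∀ y, (∀ k, HasDerivAt (fun t : ℝ => F k (x₀ + t • y)) 0 0) → y = 0) :
    ∀ᶠ x in nhds x₀, (∀ k, F k x = F k x₀) → x = x₀ := by
  have hder : HasFDerivAt (fun x k => F k x) (ContinuousLinearMap.pi fun k => fderiv ℝ (F k) x₀)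
      x₀ := hasFDerivAt_pi.2 fun k => (hF k).hasFDerivAt
  have hker : LinearMap.ker (ContinuousLinearMap.pi fun k => fderiv ℝ (F k) x₀ :
      X →L[ℝ] κ → ℝ).toLinearMap = ⊥ := by
    rw [LinearMap.ker_eq_bot']
    intro y hy
    refine hinj y fun k => ?_
    have hline : HasDerivAt (fun t : ℝ => x₀ + t • y) y 0 := by
      simpa using ((hasDerivAt_id (0 : ℝ)).smul_const y).const_add x₀
    have hk : HasFDerivAt (F k) (fderiv ℝ (F k) x₀) (x₀ + (0 : ℝ) • y) := by
      simpa using (hF k).hasFDerivAt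
    have := hk.comp_hasDerivAt 0 hline
    rwa [show fderiv ℝ (F k) x₀ y = 0 from congrFun hy k] at this
  obtain ⟨C, -, hC⟩ := LinearMap.exists_antilipschitzWith _ hker
  have := hder.eventually_ne (c := fun k => F k x₀) ⟨C, hC⟩
  rw [eventually_nhdsWithin_iff] at this
  filter_upwards [this] with x hx h
  by_contra hne
  exact hx hne (funext h)

theorem coeff_eq_zero_of_hasDerivAt {f : ℝ → ℝ} {A B C : ℝ} (hf : ∀ t, f t = A + B * t + C * t ^ 2)
    (h : HasDerivAt f 0 0) : B = 0 := by
  obtain rfl : f = fun t => A + B * t + C * t ^ 2 := funext hf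
  have h1 : HasDerivAt (fun t : ℝ => A + B * t + C * t ^ 2) B 0 := by
    refine ((((hasDerivAt_id (0 : ℝ)).const_mul B).const_add A).add
      ((hasDerivAt_pow 2 (0 : ℝ)).const_mul C)).congr_deriv ?_
    simp
  exact h1.unique h

/-- A configuration of centers, radii, and a lattice basis `(a, 0)`, `(b, d)`. -/
abbrev Config (n : ℕ) : Type := (Fin n → Pt) × (Fin n → ℝ) × ℝ × ℝ × ℝ

/-- The equations fixing the inversive distances `σ` on the edges `E`, the covolume of the lattice
and the coordinates of the center `i₀`. -/
def rigidityMap {n : ℕ} (E : Finset (Fin n × Fin n × ℤ × ℤ)) (σ : Fin n × Fin n × ℤ × ℤ → ℝ)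
    (i₀ : Fin n) : E ⊕ Fin 3 → Config n → ℝ
  | .inl c, x => edgeX x.2.2.1 x.2.2.2.1 x.1 c ^ 2 + edgeY x.2.2.2.2 x.1 c ^ 2
      - (x.2.1 c.1.1 ^ 2 + x.2.1 c.1.2.1 ^ 2 + 2 * σ c * x.2.1 c.1.1 * x.2.1 c.1.2.1)
  | .inr 0, x => x.2.2.1 * x.2.2.2.2
  | .inr 1, x => x.1 i₀ 0
  | .inr 2, x => x.1 i₀ 1

theorem differentiable_rigidityMap {n : ℕ} (E : Finset (Fin n × Fin n × ℤ × ℤ))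
    (σ : Fin n × Fin n × ℤ × ℤ → ℝ) (i₀ : Fin n) (k : E ⊕ Fin 3) :
    Differentiable ℝ (rigidityMap E σ i₀ k) := by
  have hq : ∀ (i : Fin n) (j : Fin 2), Differentiable ℝ fun x : Config n => x.1 i j :=
    fun i j => by fun_prop
  rcases k with c | k
  · have h1 := hq c.1.1
    have h2 := hq c.1.2.1
    change Differentiable ℝ fun x : Config n => edgeX x.2.2.1 x.2.2.2.1 x.1 c ^ 2
      + edgeY x.2.2.2.2 x.1 c ^ 2
      - (x.2.1 c.1.1 ^ 2 + x.2.1 c.1.2.1 ^ 2 + 2 * σ c * x.2.1 c.1.1 * x.2.1 c.1.2.1)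
    unfold edgeX edgeY
    fun_prop
  · fin_cases k
    · change Differentiable ℝ fun x : Config n => x.2.2.1 * x.2.2.2.2
      fun_prop
    · exact hq i₀ 0
    · exact hq i₀ 1

theorem norm_sub_lvec_sq (a b : ℝ) {n : ℕ} (q : Fin n → Pt) (c : Fin n × Fin n × ℤ × ℤ) :
    ‖q c.1 - (q c.2.1 - lvec a b c.2.2)‖ ^ 2 = edgeX a b q c ^ 2 + edgeY (1 / a) q c ^ 2 := by
  rw [EuclideanSpace.norm_sq_eq, Fin.sum_univ_two]
  simp only [PiLp.sub_apply, lvec_apply_zero, lvec_apply_one, Real.norm_eq_abs, sq_abs, edgeX,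
    edgeY]
  ring

theorem norm_sq_eq_of_invDist {x y : Pt} {r s σ : ℝ} (hr : 0 < r) (hs : 0 < s)
    (h : invDist x y r s = σ) : ‖x - y‖ ^ 2 = r ^ 2 + s ^ 2 + 2 * σ * r * s := by
  rw [← h, invDist]
  field_simp
  ring

theorem norm_sub_le_pdist {ι : Type} [Fintype ι] (p q : ι → Pt) (i : ι) :
    ‖p i - q i‖ ≤ pdist p q :=
  Real.le_sqrt_of_sq_le
    (Finset.single_le_sum (f := fun i => ‖p i - q i‖ ^ 2) (fun _ _ => sq_nonneg _)
      (Finset.mem_univ i))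

theorem abs_sub_le_rdist {ι : Type} [Fintype ι] (r s : ι → ℝ) (i : ι) :
    |r i - s i| ≤ rdist r s := by
  refine Real.le_sqrt_of_sq_le ?_
  rw [sq_abs]
  exact Finset.single_le_sum (f := fun i => (r i - s i) ^ 2) (fun _ _ => sq_nonneg _)
    (Finset.mem_univ i)

theorem rigidityMap_linearization_injective {a b : ℝ} {n : ℕ} {p : Fin n → Pt} {r : Fin n → ℝ}
    {E : Finset (Fin n × Fin n × ℤ × ℤ)} (ha : 0 < a) (hpack : IsPacking (latAB a b) p r)
    (htri : IsGeodesicTriangulationZ a b p E) {σ : Fin n × Fin n × ℤ × ℤ → ℝ}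
    (hσ : ∀ c ∈ E, 0 ≤ σ c)
    (hL : ∀ c ∈ E, edgeX a b p c ^ 2 + edgeY (1 / a) p c ^ 2
      = r c.1 ^ 2 + r c.2.1 ^ 2 + 2 * σ c * r c.1 * r c.2.1)
    {i₀ : Fin n} (hp : p i₀ = 0) (y : Config n)
    (hy : ∀ k, HasDerivAt
      (fun t : ℝ => rigidityMap E σ i₀ k (((p, r, a, b, 1 / a) : Config n) + t • y)) 0 0) :
    y = 0 := by
  obtain ⟨p', r', a', b', d'⟩ := y
  have h0 : p' i₀ 0 = 0 := by
    refine coeff_eq_zero_of_hasDerivAt (A := p i₀ 0) (C := 0) (fun t => ?_) (hy (.inr 1))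
    simp [rigidityMap]; ring
  have h1 : p' i₀ 1 = 0 := by
    refine coeff_eq_zero_of_hasDerivAt (A := p i₀ 1) (C := 0) (fun t => ?_) (hy (.inr 2))
    simp [rigidityMap]; ring
  have hdet : a * d' + a' * (1 / a) = 0 := by
    refine coeff_eq_zero_of_hasDerivAt (A := a * (1 / a)) (C := a' * d') (fun t => ?_)
      (hy (.inr 0))
    simp only [rigidityMap, Prod.smul_mk, Prod.mk_add_mk, smul_eq_mul]
    ring
  have hp' : p' i₀ = 0 := by
    ext j
    fin_cases j
    · exact h0
    · exact h1
  have hv : ∀ c ∈ E, edgeX a b p c * edgeX a' b' p' c + edgeY (1 / a) p c * edgeY d' p' c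
      = r c.1 ^ 2 * (r' c.1 / r c.1) + r c.2.1 ^ 2 * (r' c.2.1 / r c.2.1)
        + σ c * r c.1 * r c.2.1 * (r' c.1 / r c.1 + r' c.2.1 / r c.2.1) := by
    intro c hc
    have := coeff_eq_zero_of_hasDerivAt (A := edgeX a b p c ^ 2 + edgeY (1 / a) p c ^ 2
        - (r c.1 ^ 2 + r c.2.1 ^ 2 + 2 * σ c * r c.1 * r c.2.1))
      (B := 2 * (edgeX a b p c * edgeX a' b' p' c + edgeY (1 / a) p c * edgeY d' p' c
        - (r c.1 * r' c.1 + r c.2.1 * r' c.2.1 + σ c * (r c.1 * r' c.2.1 + r c.2.1 * r' c.1))))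
      (C := edgeX a' b' p' c ^ 2 + edgeY d' p' c ^ 2
        - (r' c.1 ^ 2 + r' c.2.1 ^ 2 + 2 * σ c * r' c.1 * r' c.2.1))
      (fun t => ?_) (hy (.inl ⟨c, hc⟩))
    · have hr₁ := (hpack.1 c.1).ne'
      have hr₂ := (hpack.1 c.2.1).ne'
      have e₁ : r c.1 ^ 2 * (r' c.1 / r c.1) = r c.1 * r' c.1 := by field_simp
      have e₂ : r c.2.1 ^ 2 * (r' c.2.1 / r c.2.1) = r c.2.1 * r' c.2.1 := by field_simp
      have e₃ : σ c * r c.1 * r c.2.1 * (r' c.1 / r c.1 + r' c.2.1 / r c.2.1)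
          = σ c * (r c.1 * r' c.2.1 + r c.2.1 * r' c.1) := by field_simp; ring
      rw [e₁, e₂, e₃]
      linarith
    · simp only [rigidityMap, edgeX, edgeY, Prod.smul_mk, Prod.mk_add_mk, smul_eq_mul,
        Pi.add_apply, Pi.smul_apply, PiLp.add_apply, PiLp.smul_apply]
      ring
  obtain ⟨rfl, hu, rfl, rfl, rfl⟩ := infinitesimal_rigidity ha hpack htri hσ hL
    (u := fun i => r' i / r i) (b' := b') hv hp hp' hdet
  have hr' : r' = 0 := funext fun i =>
    (div_eq_zero_iff.1 (congrFun hu i)).resolve_right (hpack.1 i).ne'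
  rw [hr']
  rfl

/-- **Theorem 6.1 (Guo).**  Let `(p, r)` be a packing of `n` disks in `ℝ²/Λ(a, b)`
(normalized by `p₁ = 0`) and let `E` be a geodesic triangulation of the torus on the
centers containing all contacts, with nonnegative inversive distance on every edge.
Then the packing is locally determined by its inversive distances: every nearby
normalized triple `(q, s, (a', b'))` realizing the same combinatorial triangulation `E`
with the same inversive distances on all edges equals `(p, r, (a, b))`. -/
theorem guo_local_rigidity
    (n : ℕ) (hn : 0 < n) (a b : ℝ) (ha : 0 < a)
    (p : Fin n → Pt) (r : Fin n → ℝ)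
    (hp1 : p ⟨0, hn⟩ = 0)
    (hpack : IsPacking (latAB a b) p r)
    (E : Finset (Fin n × Fin n × ℤ × ℤ))
    (hcont : ∀ c ∈ contactGraphZ a b p r, c ∈ E)
    (htri : IsGeodesicTriangulationZ a b p E)
    (hσ : ∀ c ∈ E, 0 ≤ invDist (p c.1) (p c.2.1 - lvec a b c.2.2) (r c.1) (r c.2.1)) :
    ∃ ε > 0, ∀ (q : Fin n → Pt) (s : Fin n → ℝ) (a' b' : ℝ), 0 < a' →
      q ⟨0, hn⟩ = 0 →
      pdist q p < ε → rdist s r < ε → |a' - a| < ε → |b' - b| < ε →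
      IsPacking (latAB a' b') q s →
      IsGeodesicTriangulationZ a' b' q E →
      (∀ c ∈ E, invDist (q c.1) (q c.2.1 - lvec a' b' c.2.2) (s c.1) (s c.2.1)
        = invDist (p c.1) (p c.2.1 - lvec a b c.2.2) (r c.1) (r c.2.1)) →
      q = p ∧ s = r ∧ a' = a ∧ b' = b := by
  set σ : Fin n × Fin n × ℤ × ℤ → ℝ := fun c =>
    invDist (p c.1) (p c.2.1 - lvec a b c.2.2) (r c.1) (r c.2.1)
  have hL : ∀ (q : Fin n → Pt) (s : Fin n → ℝ) (a' b' : ℝ), (∀ i, 0 < s i) →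
      ∀ c, invDist (q c.1) (q c.2.1 - lvec a' b' c.2.2) (s c.1) (s c.2.1) = σ c →
      edgeX a' b' q c ^ 2 + edgeY (1 / a') q c ^ 2
        = s c.1 ^ 2 + s c.2.1 ^ 2 + 2 * σ c * s c.1 * s c.2.1 := by
    intro q s a' b' hs c h
    rw [← norm_sub_lvec_sq, norm_sq_eq_of_invDist (hs _) (hs _) h]
  have hpL : ∀ c ∈ E, _ := fun c _ => hL p r a b hpack.1 c rfl
  have hloc := eventually_eq_of_injective_linearization
    (fun k => (differentiable_rigidityMap E σ ⟨0, hn⟩ k).differentiableAt)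
    (rigidityMap_linearization_injective ha hpack htri hσ hpL hp1)
  have hcts : ContinuousAt (fun y : (Fin n → Pt) × (Fin n → ℝ) × ℝ × ℝ =>
      ((y.1, y.2.1, y.2.2.1, y.2.2.2, 1 / y.2.2.1) : Config n)) (p, r, a, b) := by
    have : (p, r, a, b).2.2.1 ≠ 0 := ha.ne'
    fun_prop (disch := assumption)
  obtain ⟨ε, hε, H⟩ := Metric.eventually_nhds_iff.1 (hcts.eventually hloc)
  refine ⟨ε, hε, fun q s a' b' ha' hq hqp hsr haa hbb hpack' _ hinv => ?_⟩
  have hdist : dist (q, s, a', b') (p, r, a, b) < ε := by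
    simp only [Prod.dist_eq, max_lt_iff]
    refine ⟨(dist_pi_lt_iff hε).2 fun i => ?_, (dist_pi_lt_iff hε).2 fun i => ?_, haa, hbb⟩
    · rw [dist_eq_norm]
      exact (norm_sub_le_pdist q p i).trans_lt hqp
    · rw [Real.dist_eq]
      exact (abs_sub_le_rdist s r i).trans_lt hsr
  have := H hdist ?_
  · simp only [Prod.mk.injEq] at this
    exact ⟨this.1, this.2.1, this.2.2.1, this.2.2.2.1⟩
  · rintro (⟨c, hc⟩ | k)
    · simp only [rigidityMap]
      rw [hpL c hc, hL q s a' b' hpack'.1 c (hinv c hc), sub_self, sub_self]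
    · fin_cases k
      · simp only [rigidityMap]
        rw [mul_one_div_cancel ha.ne', mul_one_div_cancel ha'.ne']
      · simp [rigidityMap, hq, hp1]
      · simp [rigidityMap, hq, hp1]

end IsostaticPaper
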